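/- arXiv:1410.2442 — 11 statements merged into one kernel-verified Lean document; each statement's English description precedes it below -/
import Mathlib

section
/- For every natural number m there exists a family A : Fin m → Set ℝ such that each A i is a nonempty convex regular closed subset of ℝ and PO(A i, A j) holds for all i ≠ j. (Every atomic RCC8 network over {PO} has a convex solution in ℝ.) -/
/-- A set is regular closed if it equals the closure of its interior. -/
def RegClosed {α : Type*} [TopologicalSpace α] (X : Set α) : Prop :=
  closure (interior X) = X

/-- RCC8: disconnected. -/
def DC {α : Type*} (a b : Set α) : Prop := a ∩ b = ∅

/-- RCC8: externally connected. -/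
def EC {α : Type*} [TopologicalSpace α] (a b : Set α) : Prop :=
  (a ∩ b).Nonempty ∧ interior a ∩ interior b = ∅

/-- RCC8: partially overlaps. -/
def PO {α : Type*} [TopologicalSpace α] (a b : Set α) : Prop :=
  (interior a ∩ interior b).Nonempty ∧ ¬ a ⊆ b ∧ ¬ b ⊆ a

/-- RCC8: tangential proper part. -/
def TPP {α : Type*} [TopologicalSpace α] (a b : Set α) : Prop :=
  a ⊂ b ∧ ¬ a ⊆ interior b

/-- RCC8: non-tangential proper part. -/
def NTPP {α : Type*} [TopologicalSpace α] (a b : Set α) : Prop :=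
  a ⊆ interior b ∧ a ≠ b

/-- RCC5: discrete from. -/
def DR {α : Type*} [TopologicalSpace α] (a b : Set α) : Prop :=
  interior a ∩ interior b = ∅

/-- RCC5: proper part. -/
def PP {α : Type*} (a b : Set α) : Prop := a ⊂ b

/-- Every atomic RCC8 network over {PO} has a convex solution in ℝ. -/
theorem statement0 (m : ℕ) :
    ∃ A : Fin m → Set ℝ,
      (∀ i, (A i).Nonempty ∧ Convex ℝ (A i) ∧ RegClosed (A i)) ∧
      (∀ i j : Fin m, i ≠ j → PO (A i) (A j)) := by
  have subset_iff (i j : Fin m) :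
      Set.Icc (i : ℝ) (i + m) ⊆ Set.Icc (j : ℝ) (j + m) ↔ i = j := by
    rw [Set.Icc_subset_Icc_iff (by simp), add_le_add_iff_right, and_comm, ← le_antisymm_iff]
    exact Nat.cast_inj.trans Fin.val_inj
  have mem_interior (i : Fin m) : (m - 1 / 2 : ℝ) ∈ interior (Set.Icc (i : ℝ) (i + m)) := by
    have h : (i : ℝ) + 1 ≤ m := by exact_mod_cast i.isLt
    have h₀ : (0 : ℝ) ≤ (i : ℕ) := Nat.cast_nonneg _
    rw [interior_Icc]
    constructor <;> linarith
  refine ⟨fun i => Set.Icc (i : ℝ) (i + m), fun i => ⟨?_, convex_Icc _ _, ?_⟩, fun i j hij => ?_⟩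
  · exact ⟨_, interior_subset (mem_interior i)⟩
  · have hm : (0 : ℝ) < m := Nat.cast_pos.mpr i.pos
    rw [RegClosed, interior_Icc, closure_Ioo (by linarith)]
  · exact ⟨⟨_, mem_interior i, mem_interior j⟩, mt (subset_iff i j).mp hij,
      mt (subset_iff j i).mp hij.symm⟩
end

section
/- Let A : Fin m → Set (ℝ^d) be a family of nonempty regular closed subsets of a Euclidean space ℝ^d such that for all i ≠ j either TPP(A i, A j) or TPP(A j, A i) holds. Then there exists a family B : Fin m → Set ℝ of nonempty convex regular closed subsets of ℝ such that for all i ≠ j, TPP(B i, B j) holds if and only if TPP(A i, A j) holds. (Every consistent atomic RCC8 network over {TPP, TPP⁻¹} has a convex solution in ℝ.) -/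
/-- Nondegenerate closed intervals with the same left endpoint are tangential proper parts of each
other exactly according to their right endpoints. -/
theorem tpp_Icc_iff {x a b : ℝ} (ha : x < a) :
    TPP (Set.Icc x a) (Set.Icc x b) ↔ a < b := by
  constructor
  · rintro ⟨h, -⟩
    by_contra! hba
    exact h.2 (Set.Icc_subset_Icc_right hba)
  · intro hab
    refine ⟨⟨Set.Icc_subset_Icc_right hab.le, fun h => ?_⟩, fun h => ?_⟩
    · exact absurd (h (Set.right_mem_Icc.2 (ha.trans hab).le)).2 (not_le.2 hab)
    · rw [interior_Icc] at h
      exact lt_irrefl x (h (Set.left_mem_Icc.2 ha.le)).1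

theorem regClosed_Icc {a b : ℝ} (h : a < b) : RegClosed (Set.Icc a b) := by
  rw [RegClosed, interior_Icc, closure_Ioo h.ne]

/-- Every consistent atomic RCC8 network over {TPP, TPP⁻¹} has a convex solution in ℝ. -/
theorem statement1 (m d : ℕ) (A : Fin m → Set (EuclideanSpace ℝ (Fin d)))
    (hA : ∀ i, (A i).Nonempty ∧ RegClosed (A i))
    (hrel : ∀ i j : Fin m, i ≠ j → TPP (A i) (A j) ∨ TPP (A j) (A i)) :
    ∃ B : Fin m → Set ℝ,
      (∀ i, (B i).Nonempty ∧ Convex ℝ (B i) ∧ RegClosed (B i)) ∧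
      (∀ i j : Fin m, i ≠ j → (TPP (B i) (B j) ↔ TPP (A i) (A j))) := by
  classical
  let r : Fin m → ℕ := fun i => (Finset.univ.filter fun k => A k ⊂ A i).card
  have r_lt : ∀ i j, A i ⊂ A j → r i < r j := fun i j hij => by
    refine Finset.card_lt_card (Finset.ssubset_iff_of_subset ?_ |>.2 ⟨i, ?_, ?_⟩)
    · intro k hk
      simp only [Finset.mem_filter, Finset.mem_univ, true_and] at hk ⊢
      exact hk.trans hij
    · simpa using hij
    · simp
  have pos : ∀ i, (0 : ℝ) < r i + 1 := fun i => by positivity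
  refine ⟨fun i => Set.Icc 0 (r i + 1), fun i =>
    ⟨Set.nonempty_Icc.2 (pos i).le, convex_Icc _ _, regClosed_Icc (pos i)⟩, fun i j hij => ?_⟩
  rw [tpp_Icc_iff (pos i), add_lt_add_iff_right, Nat.cast_lt]
  refine ⟨fun h => (hrel i j hij).resolve_right fun hji => ?_, fun h => r_lt i j h.1⟩
  exact lt_asymm h (r_lt j i hji.1)
end

section
/- Let A : Fin m → Set (ℝ^d) be a family of nonempty regular closed subsets of a Euclidean space ℝ^d such that for all i ≠ j one of DC(A i, A j), NTPP(A i, A j), NTPP(A j, A i) holds. Then there exists a family B : Fin m → Set ℝ of nonempty convex regular closed subsets of ℝ such that for all i ≠ j, DC(B i, B j) holds iff DC(A i, A j) holds, and NTPP(B i, B j) holds iff NTPP(A i, A j) holds. (Every consistent atomic RCC8 network over {DC, NTPP, NTPP⁻¹} has a convex solution in ℝ.) -/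
/-- A forest order on a finite set, given by a rank `f` decreasing along `R`, has room for one more
minimal element in any interval representation. -/
theorem exists_gap_of_interval_representation {ι : Type*} (R : ι → ι → Prop) (f : ι → ℕ)
    (hf : ∀ i j, R i j → f j < f i) (htrans : ∀ i j k, R i j → R j k → R i k)
    (hforest : ∀ i j k, R i j → R i k → j = k ∨ R j k ∨ R k j)
    (s : Finset ι) (x : ι) (l r : ι → ℝ)
    (hlr : ∀ i ∈ s, l i < r i)
    (hR : ∀ i ∈ s, ∀ j ∈ s, R i j → l j < l i ∧ r i < r j)
    (hD : ∀ i ∈ s, ∀ j ∈ s, i ≠ j → ¬ R i j → ¬ R j i → r i < l j ∨ r j < l i) :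
    ∃ u v : ℝ, u < v ∧ ∀ k ∈ s,
      (R x k → l k < u ∧ v < r k) ∧ (¬ R x k → r k < u ∨ v < l k) := by
  classical
  by_cases hU : (s.filter (R x)).Nonempty
  · obtain ⟨p, hp, hpmax⟩ := Finset.exists_max_image _ f hU
    rw [Finset.mem_filter] at hp
    obtain ⟨hps, hxp⟩ := hp
    obtain ⟨M, hM, hMmax⟩ := Finset.exists_max_image
      (insert (l p) ((s.image r).filter (· < r p))) id ⟨l p, Finset.mem_insert_self _ _⟩
    have hMr : M < r p := by
      rcases Finset.mem_insert.1 hM with h | h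
      · rw [h]; exact hlr p hps
      · exact (Finset.mem_filter.1 h).2
    have hlM : l p ≤ M := hMmax _ (Finset.mem_insert_self _ _)
    have hrM : ∀ k ∈ s, r k < r p → r k ≤ M := fun k hk h ↦
      hMmax _ (Finset.mem_insert_of_mem
        (Finset.mem_filter.2 ⟨Finset.mem_image_of_mem r hk, h⟩))
    refine ⟨M + (r p - M) / 3, M + 2 * (r p - M) / 3, by linarith,
      fun k hk ↦ ⟨fun hxk ↦ ?_, fun hxk ↦ ?_⟩⟩
    · rcases hforest x p k hxp hxk with rfl | h | h
      · constructor <;> linarith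
      · have := hR p hps k hk h
        constructor <;> linarith
      · exact absurd (hf k p h) (hpmax k (Finset.mem_filter.2 ⟨hk, hxk⟩)).not_gt
    · have hkp : k ≠ p := fun h ↦ hxk (h ▸ hxp)
      have hpk : ¬ R p k := fun h ↦ hxk (htrans x p k hxp h)
      by_cases hkp' : R k p
      · have := hrM k hk (hR k hk p hps hkp').2
        left; linarith
      · rcases hD k hk p hps hkp hkp' hpk with h | h
        · left; linarith
        · right; linarith
  · obtain ⟨M, hM⟩ := (s.image r).exists_le
    have hM' : ∀ k ∈ s, r k ≤ M := fun k hk ↦ hM _ (Finset.mem_image_of_mem r hk)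
    refine ⟨M + 1, M + 2, by linarith, fun k hk ↦ ⟨fun hxk ↦ ?_, fun _ ↦ Or.inl ?_⟩⟩
    · exact absurd ⟨k, Finset.mem_filter.2 ⟨hk, hxk⟩⟩ hU
    · linarith [hM' k hk]

/-- Every finite forest order is represented by nested or disjoint intervals with distinct
endpoints. -/
theorem exists_interval_representation {ι : Type*} (R : ι → ι → Prop) (f : ι → ℕ)
    (hf : ∀ i j, R i j → f j < f i) (htrans : ∀ i j k, R i j → R j k → R i k)
    (hforest : ∀ i j k, R i j → R i k → j = k ∨ R j k ∨ R k j) (s : Finset ι) :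
    ∃ l r : ι → ℝ, (∀ i ∈ s, l i < r i) ∧
      (∀ i ∈ s, ∀ j ∈ s, R i j → l j < l i ∧ r i < r j) ∧
      (∀ i ∈ s, ∀ j ∈ s, i ≠ j → ¬ R i j → ¬ R j i → r i < l j ∨ r j < l i) := by
  classical
  induction s using Finset.induction_on_max_value f with
  | empty => exact ⟨0, 0, by simp, by simp, by simp⟩
  | insert x s hxs hmax ih =>
    obtain ⟨l, r, hlr, hR, hD⟩ := ih
    have hx : ∀ k ∈ s, ¬ R k x := fun k hk h ↦ (hmax k hk).not_gt (hf k x h)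
    have hxx : ¬ R x x := fun h ↦ (hf x x h).false
    obtain ⟨u, v, huv, hk⟩ :=
      exists_gap_of_interval_representation R f hf htrans hforest s x l r hlr hR hD
    have hne : ∀ k ∈ s, k ≠ x := fun k hk h ↦ hxs (h ▸ hk)
    refine ⟨Function.update l x u, Function.update r x v, ?_, ?_, ?_⟩
    · intro i hi
      rcases Finset.mem_insert.1 hi with rfl | his
      · simpa using huv
      · simpa [hne i his] using hlr i his
    · intro i hi j hj hij
      rcases Finset.mem_insert.1 hi with rfl | his <;> rcases Finset.mem_insert.1 hj with rfl | hjs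
      · exact absurd hij hxx
      · simpa [hne j hjs] using (hk j hjs).1 hij
      · exact absurd hij (hx i his)
      · simpa [hne i his, hne j hjs] using hR i his j hjs hij
    · intro i hi j hj hij h₁ h₂
      rcases Finset.mem_insert.1 hi with rfl | his <;> rcases Finset.mem_insert.1 hj with rfl | hjs
      · exact absurd rfl hij
      · simpa [hne j hjs] using ((hk j hjs).2 h₁).symm
      · simpa [hne i his] using (hk i his).2 h₂
      · simpa [hne i his, hne j hjs] using hD i his j hjs hij h₁ h₂

theorem NTPP.trans {α : Type*} [TopologicalSpace α] {a b c : Set α} (hab : NTPP a b)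
    (hbc : NTPP b c) : NTPP a c := by
  refine ⟨hab.1.trans (interior_subset.trans hbc.1), ?_⟩
  rintro rfl
  exact hab.2 ((hab.1.trans interior_subset).antisymm (hbc.1.trans interior_subset))

theorem NTPP.not_DC {α : Type*} [TopologicalSpace α] {a b : Set α} (hab : NTPP a b)
    (ha : a.Nonempty) : ¬ DC a b := by
  obtain ⟨x, hx⟩ := ha
  exact fun h ↦ Set.eq_empty_iff_forall_notMem.1 h x ⟨hx, interior_subset (hab.1 hx)⟩

theorem DC.symm {α : Type*} {a b : Set α} (h : DC a b) : DC b a := by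
  rwa [DC, Set.inter_comm]

theorem NTPP.asymm {α : Type*} [TopologicalSpace α] {a b : Set α} (hab : NTPP a b) :
    ¬ NTPP b a :=
  fun hba ↦ (hab.trans hba).2 rfl

theorem NTPP_Icc {a b c d : ℝ} (hca : c < a) (hbd : b < d) (hab : a < b) :
    NTPP (Set.Icc a b) (Set.Icc c d) := by
  refine ⟨?_, fun h ↦ ?_⟩
  · rw [interior_Icc]
    exact Set.Icc_subset_Ioo hca hbd
  · have : c ∈ Set.Icc a b := h ▸ Set.left_mem_Icc.2 (by linarith)
    exact this.1.not_gt hca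

theorem DC_Icc {a b c d : ℝ} (h : b < c ∨ d < a) : DC (Set.Icc a b) (Set.Icc c d) := by
  refine Set.eq_empty_iff_forall_notMem.2 fun x hx ↦ ?_
  rcases h with h | h
  · linarith [hx.1.2, hx.2.1]
  · linarith [hx.1.1, hx.2.2]

/-- Every consistent atomic RCC8 network over {DC, NTPP, NTPP⁻¹} has a convex solution in ℝ. -/
theorem statement2 (m d : ℕ) (A : Fin m → Set (EuclideanSpace ℝ (Fin d)))
    (hA : ∀ i, (A i).Nonempty ∧ RegClosed (A i))
    (hrel : ∀ i j : Fin m, i ≠ j →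
      DC (A i) (A j) ∨ NTPP (A i) (A j) ∨ NTPP (A j) (A i)) :
    ∃ B : Fin m → Set ℝ,
      (∀ i, (B i).Nonempty ∧ Convex ℝ (B i) ∧ RegClosed (B i)) ∧
      (∀ i j : Fin m, i ≠ j →
        (DC (B i) (B j) ↔ DC (A i) (A j)) ∧
        (NTPP (B i) (B j) ↔ NTPP (A i) (A j))) := by

  classical
  let R : Fin m → Fin m → Prop := fun i j ↦ NTPP (A i) (A j)
  have htrans : ∀ i j k, R i j → R j k → R i k := fun _ _ _ h h' ↦ h.trans h'
  have hirr : ∀ i, ¬ R i i := fun _ h ↦ h.2 rfl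
  have hf : ∀ i j, R i j →
      (Finset.univ.filter (R j)).card < (Finset.univ.filter (R i)).card := by
    intro i j hij
    refine Finset.card_lt_card ((Finset.ssubset_iff_of_subset fun k hk ↦ ?_).2 ⟨j, ?_, ?_⟩)
    · simp only [Finset.mem_filter, Finset.mem_univ, true_and] at hk ⊢
      exact htrans i j k hij hk
    · simpa using hij
    · simpa using hirr j
  have hforest : ∀ i j k, R i j → R i k → j = k ∨ R j k ∨ R k j := by
    intro i j k hij hik
    by_cases hjk : j = k
    · exact Or.inl hjk
    · refine Or.inr ((hrel j k hjk).resolve_left fun h ↦ ?_)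
      obtain ⟨x, hx⟩ := (hA i).1
      exact Set.eq_empty_iff_forall_notMem.1 h x
        ⟨interior_subset (hij.1 hx), interior_subset (hik.1 hx)⟩
  obtain ⟨l, r, hlr, hR, hD⟩ :=
    exists_interval_representation R _ hf htrans hforest Finset.univ
  simp only [Finset.mem_univ, true_implies] at hlr hR hD
  have hne : ∀ i, (Set.Icc (l i) (r i)).Nonempty := fun i ↦ Set.nonempty_Icc.2 (hlr i).le
  have hN : ∀ i j, NTPP (A i) (A j) → NTPP (Set.Icc (l i) (r i)) (Set.Icc (l j) (r j)) :=
    fun i j h ↦ NTPP_Icc (hR i j h).1 (hR i j h).2 (hlr i)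
  refine ⟨fun i ↦ Set.Icc (l i) (r i), fun i ↦ ⟨hne i, convex_Icc _ _, ?_⟩, fun i j hij ↦ ?_⟩
  · rw [RegClosed, interior_Icc, closure_Ioo (hlr i).ne]
  · rcases hrel i j hij with h | h | h
    · have hDC : DC (Set.Icc (l i) (r i)) (Set.Icc (l j) (r j)) :=
        DC_Icc (hD i j hij (fun h' ↦ h'.not_DC (hA i).1 h)
          fun h' ↦ h'.not_DC (hA j).1 h.symm)
      exact ⟨iff_of_true hDC h, iff_of_false (fun h' ↦ h'.not_DC (hne i) hDC)
        fun h' ↦ h'.not_DC (hA i).1 h⟩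
    · exact ⟨iff_of_false ((hN i j h).not_DC (hne i)) (h.not_DC (hA i).1),
        iff_of_true (hN i j h) h⟩
    · exact ⟨iff_of_false (fun h' ↦ (hN j i h).not_DC (hne j) h'.symm)
          fun h' ↦ h.not_DC (hA j).1 h'.symm,
        iff_of_false (hN j i h).asymm h.asymm⟩
end

section
/- There exist nonempty regular closed subsets a, b, c, d of ℝ² with TPP(a,d), TPP(b,d), TPP(c,d), DC(a,b), DC(a,c), DC(b,c); but there do not exist nonempty convex regular closed subsets a, b, c, d of ℝ satisfying these same six relations. (There is a consistent atomic RCC8 network over {DC, TPP, TPP⁻¹} with no convex solution in ℝ.) -/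
/-- A closed convex set with an interior point is regular closed. -/
theorem Convex.regClosed {E : Type*} [AddCommGroup E] [Module ℝ E] [TopologicalSpace E]
    [IsTopologicalAddGroup E] [ContinuousSMul ℝ E] {s : Set E} (hs : Convex ℝ s)
    (hc : IsClosed s) (hne : (interior s).Nonempty) : RegClosed s :=
  (hs.closure_interior_eq_closure_of_nonempty_interior hne).trans hc.closure_eq

/-- A point of a convex set of reals outside its interior is its minimum or its maximum. -/
theorem Convex.isLeast_or_isGreatest_of_notMem_interior {d : Set ℝ} (hd : Convex ℝ d) {p : ℝ}
    (hp : p ∈ d) (hi : p ∉ interior d) : IsLeast d p ∨ IsGreatest d p := by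
  by_contra! h
  have hl : ∃ x ∈ d, x < p := by
    by_contra! hx
    exact h.1 ⟨hp, hx⟩
  have hu : ∃ y ∈ d, p < y := by
    by_contra! hy
    exact h.2 ⟨hp, hy⟩
  obtain ⟨x, hx, hxp⟩ := hl
  obtain ⟨y, hy, hpy⟩ := hu
  refine hi (mem_interior.2 ⟨Set.Ioo x y, ?_, isOpen_Ioo, hxp, hpy⟩)
  exact Set.Ioo_subset_Icc_self.trans (hd.ordConnected.out hx hy)

/-- The closed upper half plane. -/
def upperHalfPlaneSet : Set (EuclideanSpace ℝ (Fin 2)) := {x | 0 ≤ x 1}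

/-- The part of the upper half plane over the interval `[s, s + 1]`. -/
def upperStrip (s : ℝ) : Set (EuclideanSpace ℝ (Fin 2)) :=
  {x | s ≤ x 0} ∩ ({x | x 0 ≤ s + 1} ∩ {x | 0 ≤ x 1})

theorem mem_upperStrip {s : ℝ} {x : EuclideanSpace ℝ (Fin 2)} :
    x ∈ upperStrip s ↔ s ≤ x 0 ∧ x 0 ≤ s + 1 ∧ 0 ≤ x 1 :=
  Iff.rfl

theorem regClosed_upperHalfPlaneSet : RegClosed upperHalfPlaneSet := by
  refine Convex.regClosed ?_ ?_ ⟨!₂[(0 : ℝ), 1], ?_⟩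
  · intro x hx y hy a b ha hb _
    simp only [upperHalfPlaneSet, Set.mem_ofPred_eq] at hx hy
    simp only [upperHalfPlaneSet, Set.mem_ofPred_eq, PiLp.add_apply, PiLp.smul_apply, smul_eq_mul]
    positivity
  · exact isClosed_le (by fun_prop) (by fun_prop)
  · refine mem_interior.2 ⟨{x | 0 < x 1}, fun x (hx : 0 < x 1) => hx.le, ?_, by simp⟩
    exact isOpen_lt (by fun_prop) (by fun_prop)

theorem regClosed_upperStrip (s : ℝ) : RegClosed (upperStrip s) := by
  refine Convex.regClosed ?_ ?_ ⟨!₂[s + 1 / 2, 1], ?_⟩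
  · intro x hx y hy a b ha hb hab
    obtain ⟨hx, hx₁, hx₂⟩ := mem_upperStrip.1 hx
    obtain ⟨hy, hy₁, hy₂⟩ := mem_upperStrip.1 hy
    simp only [mem_upperStrip, PiLp.add_apply, PiLp.smul_apply, smul_eq_mul]
    obtain rfl : b = 1 - a := by linarith
    refine ⟨?_, ?_, by positivity⟩ <;> nlinarith
  · exact (isClosed_le (by fun_prop) (by fun_prop)).inter
      ((isClosed_le (by fun_prop) (by fun_prop)).inter (isClosed_le (by fun_prop) (by fun_prop)))
  · refine mem_interior.2 ⟨{x | s < x 0} ∩ ({x | x 0 < s + 1} ∩ {x | 0 < x 1}),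
      fun x ⟨(h : s < x 0), (h₁ : x 0 < s + 1), (h₂ : 0 < x 1)⟩ =>
        mem_upperStrip.2 ⟨h.le, h₁.le, h₂.le⟩, ?_, ?_⟩
    · exact (isOpen_lt (by fun_prop) (by fun_prop)).inter
        ((isOpen_lt (by fun_prop) (by fun_prop)).inter (isOpen_lt (by fun_prop) (by fun_prop)))
    · simp
      norm_num

theorem corner_mem_upperStrip (s : ℝ) : !₂[s, 0] ∈ upperStrip s := by
  simp [upperStrip]

theorem interior_upperHalfPlaneSet : interior upperHalfPlaneSet = {x | 0 < x 1} := by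
  have hsurj : Function.Surjective (EuclideanSpace.proj 1 : EuclideanSpace ℝ (Fin 2) →L[ℝ] ℝ) :=
    fun t => ⟨!₂[(0 : ℝ), t], by simp⟩
  have h := ((EuclideanSpace.proj 1 : EuclideanSpace ℝ (Fin 2) →L[ℝ] ℝ).isOpenMap
    hsurj).preimage_interior_eq_interior_preimage
      (ContinuousLinearMap.continuous _) (Set.Ici (0 : ℝ))
  rw [interior_Ici] at h
  exact h.symm

theorem tpp_upperStrip (s : ℝ) : TPP (upperStrip s) upperHalfPlaneSet := by
  refine ⟨⟨fun x hx => hx.2.2, fun h => ?_⟩, fun h => ?_⟩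
  · have hm : !₂[s - 1, 0] ∈ upperStrip s := h (by simp [upperHalfPlaneSet])
    simp [upperStrip] at hm
    linarith
  · have hm := h (corner_mem_upperStrip s)
    rw [interior_upperHalfPlaneSet] at hm
    simp at hm

theorem dc_upperStrip {s t : ℝ} (h : s + 1 < t) : DC (upperStrip s) (upperStrip t) := by
  refine Set.eq_empty_iff_forall_notMem.2 ?_
  rintro x ⟨hs, ht⟩
  linarith [(mem_upperStrip.1 hs).2.1, (mem_upperStrip.1 ht).1]

/-- There is a consistent atomic RCC8 network over {DC, TPP, TPP⁻¹}
with no convex solution in ℝ. -/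
theorem statement3 :
    (∃ a b c d : Set (EuclideanSpace ℝ (Fin 2)),
      a.Nonempty ∧ b.Nonempty ∧ c.Nonempty ∧ d.Nonempty ∧
      RegClosed a ∧ RegClosed b ∧ RegClosed c ∧ RegClosed d ∧
      TPP a d ∧ TPP b d ∧ TPP c d ∧ DC a b ∧ DC a c ∧ DC b c) ∧
    ¬ (∃ a b c d : Set ℝ,
      a.Nonempty ∧ b.Nonempty ∧ c.Nonempty ∧ d.Nonempty ∧
      Convex ℝ a ∧ Convex ℝ b ∧ Convex ℝ c ∧ Convex ℝ d ∧
      RegClosed a ∧ RegClosed b ∧ RegClosed c ∧ RegClosed d ∧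
      TPP a d ∧ TPP b d ∧ TPP c d ∧ DC a b ∧ DC a c ∧ DC b c) := by
  constructor
  · exact ⟨upperStrip 0, upperStrip 2, upperStrip 4, upperHalfPlaneSet,
      ⟨_, corner_mem_upperStrip 0⟩, ⟨_, corner_mem_upperStrip 2⟩, ⟨_, corner_mem_upperStrip 4⟩,
      ⟨_, (tpp_upperStrip 0).1.1 (corner_mem_upperStrip 0)⟩,
      regClosed_upperStrip 0, regClosed_upperStrip 2, regClosed_upperStrip 4,
      regClosed_upperHalfPlaneSet,
      tpp_upperStrip 0, tpp_upperStrip 2, tpp_upperStrip 4,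
      dc_upperStrip (by norm_num), dc_upperStrip (by norm_num), dc_upperStrip (by norm_num)⟩
  · rintro ⟨a, b, c, d, -, -, -, -, -, -, -, hd, -, -, -, -, had, hbd, hcd, hab, hac, hbc⟩
    have key : ∀ e : Set ℝ, TPP e d → ∃ p ∈ e, IsLeast d p ∨ IsGreatest d p := by
      rintro e ⟨hed, he⟩
      obtain ⟨p, hp, hpi⟩ := Set.not_subset.1 he
      exact ⟨p, hp, hd.isLeast_or_isGreatest_of_notMem_interior (hed.1 hp) hpi⟩
    have ne : ∀ {e f : Set ℝ} {p q : ℝ}, DC e f → p ∈ e → q ∈ f → p ≠ q := by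
      rintro e f p _ hef hp hq rfl
      exact Set.eq_empty_iff_forall_notMem.1 hef p ⟨hp, hq⟩
    obtain ⟨p, hp, hp'⟩ := key a had
    obtain ⟨q, hq, hq'⟩ := key b hbd
    obtain ⟨r, hr, hr'⟩ := key c hcd
    have hpq := ne hab hp hq
    have hpr := ne hac hp hr
    have hqr := ne hbc hq hr
    rcases hp' with hp' | hp' <;> rcases hq' with hq' | hq' <;> rcases hr' with hr' | hr' <;>
      first
      | exact hpq (hp'.unique hq')
      | exact hpr (hp'.unique hr')
      | exact hqr (hq'.unique hr')
end

section
/- There exist nonempty convex regular closed subsets a, b, c, d, e, f of ℝ² with PO(a,b), PO(a,c), PO(b,c), PO(d,e), PO(d,f), PO(e,f), PP(d,a), PP(d,b), PO(d,c), PP(e,a), PP(e,c), PO(e,b), PP(f,b), PP(f,c), PO(f,a); but there do not exist nonempty convex regular closed subsets a, b, c, d, e, f of ℝ satisfying these same relations. (There is a consistent atomic RCC5 network over {PO, PP, PP⁻¹} with no convex solution in ℝ.) -/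
/-- The closed axis-parallel rectangle `[l, u] × [l', u']` in the Euclidean plane. -/
def rectangle (l u l' u' : ℝ) : Set (EuclideanSpace ℝ (Fin 2)) :=
  {p | l ≤ p 0 ∧ p 0 ≤ u ∧ l' ≤ p 1 ∧ p 1 ≤ u'}

theorem mk_mem_rectangle {l u l' u' x y : ℝ} :
    !₂[x, y] ∈ rectangle l u l' u' ↔ l ≤ x ∧ x ≤ u ∧ l' ≤ y ∧ y ≤ u' := by
  simp [rectangle]

theorem convex_rectangle (l u l' u' : ℝ) : Convex ℝ (rectangle l u l' u') := by
  rintro p ⟨h1, h2, h3, h4⟩ q ⟨k1, k2, k3, k4⟩ s t hs ht hst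
  obtain rfl : t = 1 - s := by linarith
  simp only [rectangle, Set.mem_ofPred_eq, PiLp.add_apply, PiLp.smul_apply, smul_eq_mul]
  refine ⟨?_, ?_, ?_, ?_⟩ <;> nlinarith

theorem isClosed_rectangle (l u l' u' : ℝ) : IsClosed (rectangle l u l' u') := by
  simp only [rectangle, Set.ofPred_and]
  refine IsClosed.inter ?_ (IsClosed.inter ?_ (IsClosed.inter ?_ ?_)) <;>
    exact isClosed_le (by fun_prop) (by fun_prop)

theorem mk_mem_interior_rectangle {l u l' u' x y : ℝ} (h : l < x ∧ x < u ∧ l' < y ∧ y < u') :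
    !₂[x, y] ∈ interior (rectangle l u l' u') := by
  refine mem_interior.2
    ⟨{p | l < p 0 ∧ p 0 < u ∧ l' < p 1 ∧ p 1 < u'}, ?_, ?_, by simpa using h⟩
  · rintro p ⟨h1, h2, h3, h4⟩
    exact ⟨h1.le, h2.le, h3.le, h4.le⟩
  · simp only [Set.ofPred_and]
    refine IsOpen.inter ?_ (IsOpen.inter ?_ (IsOpen.inter ?_ ?_)) <;>
      exact isOpen_lt (by fun_prop) (by fun_prop)

theorem regClosed_rectangle {l u l' u' : ℝ} (h : l < u) (h' : l' < u') :
    RegClosed (rectangle l u l' u') := by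
  have hne : (interior (rectangle l u l' u')).Nonempty :=
    ⟨!₂[(l + u) / 2, (l' + u') / 2], mk_mem_interior_rectangle
      ⟨by linarith, by linarith, by linarith, by linarith⟩⟩
  rw [RegClosed, (convex_rectangle l u l' u').closure_interior_eq_closure_of_nonempty_interior hne,
    (isClosed_rectangle l u l' u').closure_eq]

theorem rectangle_subset_rectangle_iff {l u l' u' m v m' v' : ℝ} (h : l ≤ u) (h' : l' ≤ u') :
    rectangle l u l' u' ⊆ rectangle m v m' v' ↔ m ≤ l ∧ u ≤ v ∧ m' ≤ l' ∧ u' ≤ v' := by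
  constructor
  · intro hs
    obtain ⟨h1, -, h3, -⟩ := mk_mem_rectangle.1 (hs (mk_mem_rectangle.2 ⟨le_rfl, h, le_rfl, h'⟩))
    obtain ⟨-, h2, -, h4⟩ := mk_mem_rectangle.1 (hs (mk_mem_rectangle.2 ⟨h, le_rfl, h', le_rfl⟩))
    exact ⟨h1, h2, h3, h4⟩
  · rintro ⟨h1, h2, h3, h4⟩ p ⟨k1, k2, k3, k4⟩
    exact ⟨h1.trans k1, k2.trans h2, h3.trans k3, k4.trans h4⟩

/-- Among three order-connected sets in a linear order, some two have their intersection contained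
in the third. -/
theorem Set.OrdConnected.inter_subset_of_three {α : Type*} [LinearOrder α] {a b c : Set α}
    (ha : a.OrdConnected) (hb : b.OrdConnected) (hc : c.OrdConnected) :
    a ∩ b ⊆ c ∨ a ∩ c ⊆ b ∨ b ∩ c ⊆ a := by
  by_contra! h
  obtain ⟨h1, h2, h3⟩ := h
  obtain ⟨x, ⟨xa, xb⟩, xc⟩ := Set.not_subset.1 h1
  obtain ⟨y, ⟨ya, yc⟩, yb⟩ := Set.not_subset.1 h2
  obtain ⟨z, ⟨zb, zc⟩, za⟩ := Set.not_subset.1 h3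
  rcases le_total x y with hxy | hxy <;> rcases le_total y z with hyz | hyz <;>
    rcases le_total x z with hxz | hxz
  all_goals first
    | exact xc (hc.out yc zc ⟨by assumption, by assumption⟩)
    | exact xc (hc.out zc yc ⟨by assumption, by assumption⟩)
    | exact yb (hb.out xb zb ⟨by assumption, by assumption⟩)
    | exact yb (hb.out zb xb ⟨by assumption, by assumption⟩)
    | exact za (ha.out xa ya ⟨by assumption, by assumption⟩)
    | exact za (ha.out ya xa ⟨by assumption, by assumption⟩)

/-- There is a consistent atomic RCC5 network over {PO, PP, PP⁻¹}
with no convex solution in ℝ. -/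
theorem statement4 :
    (∃ a b c d e f : Set (EuclideanSpace ℝ (Fin 2)),
      a.Nonempty ∧ b.Nonempty ∧ c.Nonempty ∧ d.Nonempty ∧ e.Nonempty ∧ f.Nonempty ∧
      Convex ℝ a ∧ Convex ℝ b ∧ Convex ℝ c ∧ Convex ℝ d ∧ Convex ℝ e ∧ Convex ℝ f ∧
      RegClosed a ∧ RegClosed b ∧ RegClosed c ∧ RegClosed d ∧ RegClosed e ∧ RegClosed f ∧
      PO a b ∧ PO a c ∧ PO b c ∧ PO d e ∧ PO d f ∧ PO e f ∧
      PP d a ∧ PP d b ∧ PO d c ∧ PP e a ∧ PP e c ∧ PO e b ∧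
      PP f b ∧ PP f c ∧ PO f a) ∧
    ¬ (∃ a b c d e f : Set ℝ,
      a.Nonempty ∧ b.Nonempty ∧ c.Nonempty ∧ d.Nonempty ∧ e.Nonempty ∧ f.Nonempty ∧
      Convex ℝ a ∧ Convex ℝ b ∧ Convex ℝ c ∧ Convex ℝ d ∧ Convex ℝ e ∧ Convex ℝ f ∧
      RegClosed a ∧ RegClosed b ∧ RegClosed c ∧ RegClosed d ∧ RegClosed e ∧ RegClosed f ∧
      PO a b ∧ PO a c ∧ PO b c ∧ PO d e ∧ PO d f ∧ PO e f ∧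
      PP d a ∧ PP d b ∧ PO d c ∧ PP e a ∧ PP e c ∧ PO e b ∧
      PP f b ∧ PP f c ∧ PO f a) := by
  constructor
  · have hpo : ∀ {a b : Set (EuclideanSpace ℝ (Fin 2))},
        !₂[5 / 2, 5 / 2] ∈ interior a → !₂[5 / 2, 5 / 2] ∈ interior b →
        ¬ a ⊆ b → ¬ b ⊆ a → PO a b := fun h h' k k' => ⟨⟨_, h, h'⟩, k, k'⟩
    have hpp : ∀ {a b : Set (EuclideanSpace ℝ (Fin 2))}, a ⊆ b → ¬ b ⊆ a → PP a b :=
      fun h k => ⟨h, k⟩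
    refine ⟨rectangle 0 3 0 3, rectangle 2 5 1 4, rectangle 1 4 2 5,
      rectangle 2 3 1 3, rectangle 1 3 2 3, rectangle 2 4 2 4, ?_⟩
    refine ⟨?_, ?_, ?_, ?_, ?_, ?_, convex_rectangle .., convex_rectangle ..,
      convex_rectangle .., convex_rectangle .., convex_rectangle .., convex_rectangle ..,
      ?_, ?_, ?_, ?_, ?_, ?_, ?_, ?_, ?_, ?_, ?_, ?_, ?_, ?_, ?_, ?_, ?_, ?_, ?_, ?_, ?_⟩
    all_goals first
      | exact ⟨_, interior_subset (mk_mem_interior_rectangle (x := 5 / 2) (y := 5 / 2)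
          (by norm_num))⟩
      | exact regClosed_rectangle (by norm_num) (by norm_num)
      | refine hpo (mk_mem_interior_rectangle (by norm_num))
          (mk_mem_interior_rectangle (by norm_num)) ?_ ?_ <;>
        rw [rectangle_subset_rectangle_iff (by norm_num) (by norm_num)] <;> norm_num
      | refine hpp ?_ ?_ <;>
        rw [rectangle_subset_rectangle_iff (by norm_num) (by norm_num)] <;> norm_num
  · rintro ⟨a, b, c, d, e, f, -, -, -, -, -, -, ha, hb, hc, -, -, -, -, -, -, -, -, -,
      -, -, -, -, -, -, hda, hdb, hdc, hea, hec, heb, hfb, hfc, hfa⟩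
    rcases ha.ordConnected.inter_subset_of_three hb.ordConnected hc.ordConnected with h | h | h
    · exact hdc.2.1 ((Set.subset_inter hda.1 hdb.1).trans h)
    · exact heb.2.1 ((Set.subset_inter hea.1 hec.1).trans h)
    · exact hfa.2.1 ((Set.subset_inter hfb.1 hfc.1).trans h)
end

section
/- There exist nonempty regular closed subsets a₁, a₂, a₃, a₄ of ℝ² with TPP(a₁,a₂), TPP(a₁,a₃), NTPP(a₁,a₄), TPP(a₂,a₃), TPP(a₂,a₄), TPP(a₃,a₄); but there do not exist nonempty convex regular closed subsets a₁, a₂, a₃, a₄ of ℝ satisfying these same six relations. (There is a consistent atomic RCC8 network over {TPP, TPP⁻¹, NTPP, NTPP⁻¹} with no convex solution in ℝ.) -/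
section Preimage

variable {α β : Type*} [TopologicalSpace α] [TopologicalSpace β] {f : α → β} {s t : Set β}

theorem RegClosed.preimage (hs : RegClosed s) (hf : Continuous f) (ho : IsOpenMap f) :
    RegClosed (f ⁻¹' s) := by
  unfold RegClosed
  rw [← ho.preimage_interior_eq_interior_preimage hf, ← ho.preimage_closure_eq_closure_preimage hf,
    hs]

theorem TPP.preimage (h : TPP s t) (hf : Continuous f) (ho : IsOpenMap f)
    (hsurj : Function.Surjective f) : TPP (f ⁻¹' s) (f ⁻¹' t) := by
  unfold TPP
  rwa [← ho.preimage_interior_eq_interior_preimage hf, hsurj.preimage_subset_preimage_iff,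
    ssubset_iff_subset_not_subset, hsurj.preimage_subset_preimage_iff,
    hsurj.preimage_subset_preimage_iff, ← ssubset_iff_subset_not_subset]

theorem NTPP.preimage (h : NTPP s t) (hf : Continuous f) (ho : IsOpenMap f)
    (hsurj : Function.Surjective f) : NTPP (f ⁻¹' s) (f ⁻¹' t) := by
  unfold NTPP
  rw [← ho.preimage_interior_eq_interior_preimage hf]
  exact ⟨Set.preimage_mono h.1, fun e => h.2 (hsurj.preimage_injective e)⟩

theorem RegClosed.union (hs : RegClosed s) (ht : RegClosed t) : RegClosed (s ∪ t) := by
  unfold RegClosed at *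
  apply subset_antisymm
  · have : IsClosed (s ∪ t) := by
      rw [← hs, ← ht]
      exact isClosed_closure.union isClosed_closure
    exact closure_minimal interior_subset this
  · conv_lhs => rw [← hs, ← ht]
    exact Set.union_subset (closure_mono (interior_mono Set.subset_union_left))
      (closure_mono (interior_mono Set.subset_union_right))

end Preimage

theorem TPP.of_mem {α : Type*} [TopologicalSpace α] {s t : Set α} {x y : α} (h : s ⊆ t)
    (hyt : y ∈ t) (hys : y ∉ s) (hxs : x ∈ s) (hxt : x ∉ interior t) : TPP s t :=
  ⟨⟨h, fun h' => hys (h' hyt)⟩, fun h' => hxt (h' hxs)⟩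

theorem regClosed_Ici (a : ℝ) : RegClosed (Set.Ici a) := by
  rw [RegClosed, interior_Ici, closure_Ioi]

theorem notMem_interior_of_disjoint_Ioo {s : Set ℝ} {a b : ℝ} (hab : a < b)
    (h : s ⊆ (Set.Ioo a b)ᶜ) : b ∉ interior s := by
  intro hb
  have := interior_mono h hb
  rw [interior_compl, closure_Ioo hab.ne] at this
  exact this ⟨hab.le, le_rfl⟩

/-- The network is realised on the line once disconnected regions are allowed. -/
theorem exists_regClosed_real_network :
    ∃ a₁ a₂ a₃ a₄ : Set ℝ,
      a₁.Nonempty ∧ a₂.Nonempty ∧ a₃.Nonempty ∧ a₄.Nonempty ∧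
      RegClosed a₁ ∧ RegClosed a₂ ∧ RegClosed a₃ ∧ RegClosed a₄ ∧
      TPP a₁ a₂ ∧ TPP a₁ a₃ ∧ NTPP a₁ a₄ ∧ TPP a₂ a₃ ∧ TPP a₂ a₄ ∧ TPP a₃ a₄ := by
  have h₂ : (2 : ℝ) ∉ interior (Set.Icc (0 : ℝ) 1 ∪ Set.Icc 2 4) := by
    refine notMem_interior_of_disjoint_Ioo one_lt_two ?_
    rintro x (hx | hx) hx'
    exacts [hx'.1.not_ge hx.2, hx'.2.not_ge hx.1]
  have h₃ : (2 : ℝ) ∉ interior (Set.Icc (0 : ℝ) 1 ∪ Set.Ici 2) := by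
    refine notMem_interior_of_disjoint_Ioo one_lt_two ?_
    rintro x (hx | hx) hx'
    exacts [hx'.1.not_ge hx.2, hx'.2.not_ge hx]
  have h₄ : (0 : ℝ) ∉ interior (Set.Ici (0 : ℝ)) := by simp
  refine ⟨Set.Icc 2 3, Set.Icc 0 1 ∪ Set.Icc 2 4, Set.Icc 0 1 ∪ Set.Ici 2, Set.Ici 0,
    ⟨2, by norm_num⟩, ⟨2, by norm_num⟩, ⟨2, by norm_num⟩, ⟨2, by norm_num⟩,
    regClosed_Icc (by norm_num),
    (regClosed_Icc (by norm_num)).union (regClosed_Icc (by norm_num)),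
    (regClosed_Icc (by norm_num)).union (regClosed_Ici 2), regClosed_Ici 0,
    .of_mem (y := 0) ?_ ?_ ?_ ?_ h₂, .of_mem (y := 0) ?_ ?_ ?_ ?_ h₃, ⟨?_, ?_⟩,
    .of_mem (y := 5) ?_ ?_ ?_ ?_ h₃, .of_mem (y := 5) ?_ ?_ ?_ ?_ h₄,
    .of_mem (y := 3 / 2) ?_ ?_ ?_ ?_ h₄⟩
  all_goals first
    | norm_num; done
    | intro x hx
      simp only [Set.mem_union, Set.mem_Icc, Set.mem_Ici, interior_Ici, Set.mem_Ioi] at hx ⊢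
      grind
    | intro h
      have : (0 : ℝ) ∈ Set.Icc (2 : ℝ) 3 := h ▸ Set.self_mem_Ici
      norm_num at this

theorem Convex.mem_interior_of_lt_of_lt {s : Set ℝ} (hs : Convex ℝ s) {x y z : ℝ} (hx : x ∈ s)
    (hz : z ∈ s) (hxy : x < y) (hyz : y < z) : y ∈ interior s :=
  mem_interior_iff_mem_nhds.2 <|
    Filter.mem_of_superset (Icc_mem_nhds hxy hyz) (hs.ordConnected.out hx hz)

theorem Convex.subset_Icc_of_notMem_interior {s : Set ℝ} (hs : Convex ℝ s) {x y : ℝ}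
    (hx : x ∈ s) (hy : y ∈ s) (hx' : x ∉ interior s) (hy' : y ∉ interior s) (h : x < y) :
    s ⊆ Set.Icc x y := fun _ hz =>
  ⟨not_lt.1 fun hzx => hx' (hs.mem_interior_of_lt_of_lt hz hy hzx h),
    not_lt.1 fun hyz => hy' (hs.mem_interior_of_lt_of_lt hx hz h hyz)⟩

/-- There is a consistent atomic RCC8 network over {TPP, TPP⁻¹, NTPP, NTPP⁻¹}
with no convex solution in ℝ. -/
theorem statement5 :
    (∃ a₁ a₂ a₃ a₄ : Set (EuclideanSpace ℝ (Fin 2)),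
      a₁.Nonempty ∧ a₂.Nonempty ∧ a₃.Nonempty ∧ a₄.Nonempty ∧
      RegClosed a₁ ∧ RegClosed a₂ ∧ RegClosed a₃ ∧ RegClosed a₄ ∧
      TPP a₁ a₂ ∧ TPP a₁ a₃ ∧ NTPP a₁ a₄ ∧ TPP a₂ a₃ ∧ TPP a₂ a₄ ∧ TPP a₃ a₄) ∧
    ¬ (∃ a₁ a₂ a₃ a₄ : Set ℝ,
      a₁.Nonempty ∧ a₂.Nonempty ∧ a₃.Nonempty ∧ a₄.Nonempty ∧
      Convex ℝ a₁ ∧ Convex ℝ a₂ ∧ Convex ℝ a₃ ∧ Convex ℝ a₄ ∧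
      RegClosed a₁ ∧ RegClosed a₂ ∧ RegClosed a₃ ∧ RegClosed a₄ ∧
      TPP a₁ a₂ ∧ TPP a₁ a₃ ∧ NTPP a₁ a₄ ∧ TPP a₂ a₃ ∧ TPP a₂ a₄ ∧ TPP a₃ a₄) := by
  constructor
  · obtain ⟨a₁, a₂, a₃, a₄, n₁, n₂, n₃, n₄, r₁, r₂, r₃, r₄, h₁₂, h₁₃, h₁₄, h₂₃, h₂₄, h₃₄⟩ :=
      exists_regClosed_real_network
    let f : EuclideanSpace ℝ (Fin 2) →L[ℝ] ℝ := EuclideanSpace.proj 0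
    have hs : Function.Surjective f := fun c => ⟨EuclideanSpace.single 0 c, by simp [f]⟩
    have hc : Continuous f := f.continuous
    have ho : IsOpenMap f := f.isOpenMap hs
    exact ⟨f ⁻¹' a₁, f ⁻¹' a₂, f ⁻¹' a₃, f ⁻¹' a₄,
      n₁.preimage hs, n₂.preimage hs, n₃.preimage hs, n₄.preimage hs,
      r₁.preimage hc ho, r₂.preimage hc ho, r₃.preimage hc ho, r₄.preimage hc ho,
      h₁₂.preimage hc ho hs, h₁₃.preimage hc ho hs, h₁₄.preimage hc ho hs,
      h₂₃.preimage hc ho hs, h₂₄.preimage hc ho hs, h₃₄.preimage hc ho hs⟩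
  · rintro ⟨a₁, a₂, a₃, a₄, -, -, -, -, -, c₂, c₃, -, -, -, -, -, h₁₂, h₁₃, h₁₄, h₂₃, h₂₄, h₃₄⟩
    obtain ⟨x, hx₁, hx₃⟩ := Set.not_subset.1 h₁₃.2
    obtain ⟨y, hy₂, hy₄⟩ := Set.not_subset.1 h₂₄.2
    have hx₂ : x ∈ a₂ := h₁₂.1.1 hx₁
    have hy₃ : y ∉ interior a₃ := fun h => hy₄ (interior_mono h₃₄.1.1 h)
    have hxy : x ≠ y := fun h => hy₄ (h ▸ h₁₄.1 hx₁)
    refine h₂₃.1.2 ?_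
    rcases hxy.lt_or_gt with h | h
    · exact (c₃.subset_Icc_of_notMem_interior (h₂₃.1.1 hx₂) (h₂₃.1.1 hy₂) hx₃ hy₃ h).trans
        (c₂.ordConnected.out hx₂ hy₂)
    · exact (c₃.subset_Icc_of_notMem_interior (h₂₃.1.1 hy₂) (h₂₃.1.1 hx₂) hy₃ hx₃ h).trans
        (c₂.ordConnected.out hy₂ hx₂)
end

section
/- Let A : Fin m → Set (ℝ^d) be a family of nonempty regular closed subsets of a Euclidean space ℝ^d such that for all i ≠ j one of DC(A i, A j), TPP(A i, A j), TPP(A j, A i), NTPP(A i, A j), NTPP(A j, A i) holds. Then there exists a family B : Fin m → Set ℝ² of nonempty convex regular closed subsets of ℝ² such that for all i ≠ j, DC(B i, B j) holds iff DC(A i, A j) holds, TPP(B i, B j) holds iff TPP(A i, A j) holds, and NTPP(B i, B j) holds iff NTPP(A i, A j) holds. (Every consistent atomic RCC8 network over {DC, TPP, TPP⁻¹, NTPP, NTPP⁻¹} has a convex solution in ℝ².) -/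
open Topology in
/-- A laminar family of nonempty sets, indexed by a finite set, is represented by real intervals:
strict inclusion becomes inclusion in the interior and disjoint sets get disjoint intervals. -/
theorem exists_intervals_of_laminar {ι X : Type*} (A : ι → Set X)
    (hne : ∀ i, (A i).Nonempty)
    (hlam : ∀ i j, i ≠ j → A i ∩ A j = ∅ ∨ A i ⊂ A j ∨ A j ⊂ A i) (s : Finset ι) :
    ∃ l r : ι → ℝ, (∀ i ∈ s, l i < r i) ∧
      (∀ i ∈ s, ∀ j ∈ s, A i ⊂ A j → l j < l i ∧ r i < r j) ∧
      (∀ i ∈ s, ∀ j ∈ s, A i ∩ A j = ∅ → r i < l j ∨ r j < l i) := by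
  classical
  induction s using Finset.strongInduction with
  | H s ih =>
    rcases s.eq_empty_or_nonempty with rfl | hs
    · exact ⟨0, 0, by simp, by simp, by simp⟩
    obtain ⟨i, hi, hmin⟩ := s.exists_minimalFor A hs
    have hnot : ∀ j ∈ s, ¬ A j ⊂ A i := fun j hj h => h.2 (hmin hj h.1)
    obtain ⟨l, r, hlr, hsub, hdis⟩ := ih (s.erase i) (Finset.erase_ssubset hi)
    have hself : A i ∩ A i ≠ ∅ := by simpa using (hne i).ne_empty
    suffices h : ∃ x y : ℝ, x < y ∧ (∀ j ∈ s.erase i, A i ⊂ A j → l j < x ∧ y < r j) ∧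
        (∀ j ∈ s.erase i, A i ∩ A j = ∅ → y < l j ∨ r j < x) by
      obtain ⟨x, y, hxy, h1, h2⟩ := h
      refine ⟨Function.update l i x, Function.update r i y, ?_, ?_, ?_⟩
      · intro j hj
        by_cases hji : j = i
        · subst hji; simpa using hxy
        · simpa [hji] using hlr j (Finset.mem_erase.2 ⟨hji, hj⟩)
      · intro j hj k hk hjk
        by_cases hki : k = i
        · subst hki; exact absurd hjk (hnot j hj)
        have hk' := Finset.mem_erase.2 ⟨hki, hk⟩
        by_cases hji : j = i
        · subst hji; simpa [hki] using h1 k hk' hjk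
        · simpa [hji, hki] using hsub j (Finset.mem_erase.2 ⟨hji, hj⟩) k hk' hjk
      · intro j hj k hk hjk
        by_cases hji : j = i
        · subst hji
          by_cases hkj : k = j
          · subst hkj; exact absurd hjk hself
          · simpa [hkj] using h2 k (Finset.mem_erase.2 ⟨hkj, hk⟩) hjk
        · have hj' := Finset.mem_erase.2 ⟨hji, hj⟩
          by_cases hki : k = i
          · subst hki
            simpa [hji] using (h2 j hj' (by rwa [Set.inter_comm])).symm
          · simpa [hji, hki] using hdis j hj' k (Finset.mem_erase.2 ⟨hki, hk⟩) hjk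
    by_cases hp : ∃ k ∈ s.erase i, A i ⊂ A k
    · obtain ⟨k, hk, hkmin⟩ := ((s.erase i).filter (A i ⊂ A ·)).exists_minimalFor A
        (by obtain ⟨k, hk, h⟩ := hp; exact ⟨k, Finset.mem_filter.2 ⟨hk, h⟩⟩)
      rw [Finset.mem_filter] at hk
      have hev : ∀ᶠ u in 𝓝[>] (l k), l k < u ∧ u < r k ∧
          ∀ j ∈ s.erase i, l k < l j → u < l j := by
        refine (eventually_mem_nhdsWithin).and
          (((eventually_lt_nhds (hlr k hk.1)).filter_mono nhdsWithin_le_nhds).and ?_)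
        rw [Filter.eventually_all_finset]
        intro j _
        by_cases hj : l k < l j
        · filter_upwards [(eventually_lt_nhds hj).filter_mono nhdsWithin_le_nhds] with u hu _
          exact hu
        · exact Filter.Eventually.of_forall fun u h => absurd h hj
      obtain ⟨u, hu1, hu2, hu3⟩ := hev.exists
      have hkey : ∀ j ∈ s.erase i, j ≠ k → A j ∩ A k = ∅ ∨ A j ⊂ A k ∨ A k ⊂ A j :=
        fun j _ hjk => hlam j k hjk
      refine ⟨(l k + u) / 2, u, by linarith, ?_, ?_⟩
      · intro j hj hij
        by_cases hjk : j = k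
        · subst hjk; constructor <;> linarith
        rcases hkey j hj hjk with h | h | h
        · exfalso
          obtain ⟨a, ha⟩ := hne i
          exact (Set.eq_empty_iff_forall_notMem.1 h) a ⟨hij.1 ha, hk.2.1 ha⟩
        · exact absurd (hkmin (Finset.mem_filter.2 ⟨hj, hij⟩) h.1) h.2
        · obtain ⟨h1, h2⟩ := hsub k hk.1 j hj h
          constructor <;> linarith
      · intro j hj hij
        have hnot' : ¬ A i ⊆ A j := by
          intro h
          obtain ⟨a, ha⟩ := hne i
          exact (Set.eq_empty_iff_forall_notMem.1 hij) a ⟨ha, h ha⟩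
        by_cases hjk : j = k
        · subst hjk; exact absurd hk.2.1 hnot'
        rcases hkey j hj hjk with h | h | h
        · rcases hdis j hj k hk.1 h with h | h
          · right; linarith
          · left; linarith
        · left; exact hu3 j hj (hsub j hj k hk.1 h).1
        · exact absurd (hk.2.1.trans h.1) hnot'
    · push Not at hp
      obtain ⟨M, hM⟩ := ((s.erase i).image r).bddAbove
      refine ⟨M + 1, M + 2, by linarith, fun j hj h => absurd h (hp j hj), fun j hj _ => ?_⟩
      right
      have : r j ≤ M := hM (Finset.mem_coe.2 (Finset.mem_image_of_mem r hj))
      linarith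

/-- The rank of the pair `(k, e)`: the offset of the supporting line of direction `e` for the
polygon representing `A k`, in units of a small positive number. -/
noncomputable def supportRank {ι X : Type*} [Fintype ι] [TopologicalSpace X] (A : ι → Set X)
    (k e : ι) : ℕ :=
  open Classical in
  if A e ⊆ A k then
    Fintype.card ι + 1 + (Finset.univ.filter fun j => A j ⊆ A k ∧ A e ⊆ interior (A j)).card
  else (Finset.univ.filter fun j => A j ⊆ A k).card

section supportRank

variable {ι X : Type*} [Fintype ι] [TopologicalSpace X] (A : ι → Set X)

theorem supportRank_le (k e : ι) : supportRank A k e ≤ 2 * Fintype.card ι + 1 := by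
  classical
  unfold supportRank
  split_ifs
  · refine (Nat.add_le_add_left (Finset.card_le_univ _) _).trans ?_
    omega
  · refine (Finset.card_le_univ _).trans ?_
    omega

theorem supportRank_mono {i k : ι} (hik : A i ⊆ A k) (e : ι) :
    supportRank A i e ≤ supportRank A k e := by
  classical
  unfold supportRank
  split_ifs with h1 h2 h2
  · gcongr
  · exact absurd (h1.trans hik) h2
  · refine (Finset.card_le_univ _).trans ?_
    omega
  · gcongr

theorem supportRank_lt {i k : ι} (hik : A i ⊂ A k) (hN : A i ⊆ interior (A k)) (e : ι) :
    supportRank A i e < supportRank A k e := by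
  classical
  unfold supportRank
  split_ifs with h1 h2 h2
  · gcongr
    refine Finset.ssubset_iff_of_subset (fun j => ?_) |>.2 ⟨k, ?_, ?_⟩
    · simpa using fun h h' => ⟨h.trans hik.1, h'⟩
    · simpa using h1.trans hN
    · simpa using fun h => absurd h hik.2
  · exact absurd (h1.trans hik.1) h2
  · refine (Finset.card_le_univ _).trans_lt ?_
    omega
  · apply Finset.card_lt_card
    refine Finset.ssubset_iff_of_subset (fun j => ?_) |>.2 ⟨k, ?_, ?_⟩
    · simpa using fun h => h.trans hik.1
    · simp
    · simpa using hik.2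

theorem supportRank_eq {i k : ι} (hik : A i ⊆ A k) (hT : ¬ A i ⊆ interior (A k)) :
    supportRank A i i = supportRank A k i := by
  classical
  have h0 : ∀ l, A l ⊆ A k →
      (Finset.univ.filter fun j => A j ⊆ A l ∧ A i ⊆ interior (A j)) = ∅ := by
    intro l hl
    refine Finset.filter_eq_empty_iff.2 fun j _ h => hT ?_
    exact h.2.trans (interior_mono (h.1.trans hl))
  simp [supportRank, hik, h0 i hik, h0 k subset_rfl]

end supportRank

/-- The polygon cut out of a vertical strip by an upper bound on the second coordinate and by the
half-planes above the lines `y = 2 * p e * x - p e ^ 2 - c e`. -/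
def polygon {ι : Type*} (p : ι → ℝ) (l r D : ℝ) (c : ι → ℝ) : Set (EuclideanSpace ℝ (Fin 2)) :=
  {z | l ≤ z 0 ∧ z 0 ≤ r ∧ z 1 ≤ D ∧ ∀ e, 2 * p e * z 0 - p e ^ 2 - c e ≤ z 1}

/-- The strict version of `polygon`. -/
def openPolygon {ι : Type*} (p : ι → ℝ) (l r D : ℝ) (c : ι → ℝ) :
    Set (EuclideanSpace ℝ (Fin 2)) :=
  {z | l < z 0 ∧ z 0 < r ∧ z 1 < D ∧ ∀ e, 2 * p e * z 0 - p e ^ 2 - c e < z 1}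

section polygon

variable {ι : Type*} {p : ι → ℝ} {l r D l' r' D' : ℝ} {c c' : ι → ℝ}

theorem polygon_mono (hl : l' ≤ l) (hr : r ≤ r') (hD : D ≤ D') (hc : ∀ e, c e ≤ c' e) :
    polygon p l r D c ⊆ polygon p l' r' D' c' := by
  rintro z ⟨h1, h2, h3, h4⟩
  exact ⟨hl.trans h1, h2.trans hr, h3.trans hD, fun e => by linarith [h4 e, hc e]⟩

theorem polygon_subset_openPolygon (hl : l' < l) (hr : r < r') (hD : D < D')
    (hc : ∀ e, c e < c' e) : polygon p l r D c ⊆ openPolygon p l' r' D' c' := by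
  rintro z ⟨h1, h2, h3, h4⟩
  exact ⟨hl.trans_le h1, h2.trans_lt hr, h3.trans_lt hD, fun e => by linarith [h4 e, hc e]⟩

theorem isOpen_openPolygon [Finite ι] : IsOpen (openPolygon p l r D c) := by
  have h : openPolygon p l r D c = {z | l < z 0} ∩ ({z | z 0 < r} ∩ ({z | z 1 < D} ∩
      ⋂ e, {z | 2 * p e * z 0 - p e ^ 2 - c e < z 1})) := by
    ext z; simp [openPolygon]
  rw [h]
  exact (isOpen_lt (by fun_prop) (by fun_prop)).inter <|
    (isOpen_lt (by fun_prop) (by fun_prop)).inter <|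
    (isOpen_lt (by fun_prop) (by fun_prop)).inter <|
    isOpen_iInter_of_finite fun e => isOpen_lt (by fun_prop) (by fun_prop)

theorem isClosed_polygon : IsClosed (polygon p l r D c) := by
  have h : polygon p l r D c = {z | l ≤ z 0} ∩ ({z | z 0 ≤ r} ∩ ({z | z 1 ≤ D} ∩
      ⋂ e, {z | 2 * p e * z 0 - p e ^ 2 - c e ≤ z 1})) := by
    ext z; simp [polygon]
  rw [h]
  exact (isClosed_le (by fun_prop) (by fun_prop)).inter <|
    (isClosed_le (by fun_prop) (by fun_prop)).inter <|
    (isClosed_le (by fun_prop) (by fun_prop)).inter <|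
    isClosed_iInter fun e => isClosed_le (by fun_prop) (by fun_prop)

theorem openPolygon_subset_interior [Finite ι] :
    openPolygon p l r D c ⊆ interior (polygon p l r D c) :=
  interior_maximal (fun _ h => ⟨h.1.le, h.2.1.le, h.2.2.1.le, fun e => (h.2.2.2 e).le⟩)
    isOpen_openPolygon

theorem convex_polygon : Convex ℝ (polygon p l r D c) := by
  rintro x ⟨h1, h2, h3, h4⟩ y ⟨k1, k2, k3, k4⟩ a b ha hb hab
  obtain rfl : b = 1 - a := by linarith
  refine ⟨?_, ?_, ?_, fun e => ?_⟩ <;>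
    simp only [PiLp.add_apply, PiLp.smul_apply, smul_eq_mul]
  · nlinarith
  · nlinarith
  · nlinarith
  · nlinarith [mul_le_mul_of_nonneg_left (h4 e) ha, mul_le_mul_of_nonneg_left (k4 e) hb]

theorem openPolygon_nonempty (hlr : l < r) (hl : l ^ 2 < D) (hr : r ^ 2 < D)
    (hc : ∀ e, 0 < c e) : (openPolygon p l r D c).Nonempty := by
  refine ⟨!₂[(l + r) / 2, ((l + r) / 2) ^ 2], ?_⟩
  refine ⟨?_, ?_, ?_, fun e => ?_⟩ <;> simp
  · linarith
  · linarith
  · nlinarith [sq_nonneg (l - r)]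
  · nlinarith [sq_nonneg ((l + r) / 2 - p e), hc e]

theorem regClosed_polygon [Finite ι] (h : (openPolygon p l r D c).Nonempty) :
    RegClosed (polygon p l r D c) := by
  rw [RegClosed, convex_polygon.closure_interior_eq_closure_of_nonempty_interior
    (h.mono openPolygon_subset_interior), isClosed_polygon.closure_eq]

/-- The polygon touches its supporting line of slope `2 * p i` above `p i`, as long as the offsets
are smaller than the squared gaps between the points `p e`. -/
theorem touchPoint_mem_polygon {i : ι} (hl : l ≤ p i) (hr : p i ≤ r) (hD : p i ^ 2 ≤ D)
    (hc : ∀ e, 0 ≤ c e) (hgap : ∀ e, e ≠ i → c i ≤ (p e - p i) ^ 2) :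
    !₂[p i, p i ^ 2 - c i] ∈ polygon p l r D c := by
  refine ⟨by simpa using hl, by simpa using hr, ?_, fun e => ?_⟩
  · simp; linarith [hc i]
  · simp
    by_cases he : e = i
    · subst he; nlinarith
    · nlinarith [hgap e he, hc e]

theorem touchPoint_notMem_interior {i : ι} :
    !₂[p i, p i ^ 2 - c i] ∉ interior (polygon p l r D c) := by
  intro h
  have hcont : Continuous fun t : ℝ => (!₂[p i, p i ^ 2 - c i - t] : EuclideanSpace ℝ (Fin 2)) := by
    refine (PiLp.continuous_toLp 2 _).comp (continuous_pi fun j => ?_)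
    fin_cases j <;> simp <;> fun_prop
  have hmem : ∀ᶠ t : ℝ in nhds 0, !₂[p i, p i ^ 2 - c i - t] ∈ polygon p l r D c :=
    hcont.continuousAt.eventually (by simpa using mem_interior_iff_mem_nhds.1 h)
  obtain ⟨t, ht, htpos⟩ := ((hmem.filter_mono nhdsWithin_le_nhds).and
    (eventually_mem_nhdsWithin (s := Set.Ioi (0 : ℝ)))).exists
  have := ht.2.2.2 i
  simp at this htpos
  nlinarith

end polygon

theorem exists_pos_mul_le_sq_sub {ι : Type*} [Finite ι] {p : ι → ℝ} (hp : Function.Injective p)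
    (n : ℝ) : ∃ ε > 0, ∀ i j, i ≠ j → ε * n ≤ (p i - p j) ^ 2 := by
  have h : ∀ᶠ ε : ℝ in nhdsWithin 0 (Set.Ioi 0), ∀ i j, i ≠ j → ε * n ≤ (p i - p j) ^ 2 := by
    simp only [Filter.eventually_all]
    intro i j hij
    have hpos : (0 : ℝ) * n < (p i - p j) ^ 2 := by
      have := sub_ne_zero.2 (hp.ne hij)
      rw [zero_mul]; positivity
    have hc : Continuous fun ε : ℝ => ε * n := by fun_prop
    filter_upwards [(hc.continuousAt.eventually_lt continuousAt_const hpos).filter_mono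
      nhdsWithin_le_nhds] with ε hε using hε.le
  obtain ⟨ε, h1, h2⟩ := (h.and eventually_mem_nhdsWithin).exists
  exact ⟨ε, h2, h1⟩

/-- The relations `DC`, `TPP`, `TPP⁻¹`, `NTPP`, `NTPP⁻¹` exclude each other on nonempty sets, so a
map preserving them also reflects them. -/
theorem rcc_iff_of_imp {α β : Type*} [TopologicalSpace α] [TopologicalSpace β] {a a' : Set α}
    {b b' : Set β} (hb : b.Nonempty) (hb' : b'.Nonempty)
    (hrel : DC a a' ∨ TPP a a' ∨ TPP a' a ∨ NTPP a a' ∨ NTPP a' a)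
    (hDC : DC a a' → DC b b') (hT : TPP a a' → TPP b b') (hT' : TPP a' a → TPP b' b)
    (hN : NTPP a a' → NTPP b b') (hN' : NTPP a' a → NTPP b' b) :
    (DC b b' ↔ DC a a') ∧ (TPP b b' ↔ TPP a a') ∧ (NTPP b b' ↔ NTPP a a') := by
  have hdc : DC b b' → ¬ b ⊆ b' ∧ ¬ b' ⊆ b := by
    intro h
    constructor <;> intro hs
    · rw [DC, Set.inter_eq_left.2 hs] at h
      exact hb.ne_empty h
    · rw [DC, Set.inter_eq_right.2 hs] at h
      exact hb'.ne_empty h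
  have ht : TPP b b' → b ⊆ b' ∧ ¬ b' ⊆ b := fun h => h.1
  have ht' : TPP b' b → b' ⊆ b ∧ ¬ b ⊆ b' := fun h => h.1
  have hn : NTPP b b' → b ⊆ b' ∧ ¬ b' ⊆ b := fun h =>
    ⟨h.1.trans interior_subset, fun h' => h.2 ((h.1.trans interior_subset).antisymm h')⟩
  have hn' : NTPP b' b → b' ⊆ b ∧ ¬ b ⊆ b' := fun h =>
    ⟨h.1.trans interior_subset, fun h' => h.2 ((h.1.trans interior_subset).antisymm h')⟩
  have htn : TPP b b' → ¬ NTPP b b' := fun h h' => h.2 h'.1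
  rcases hrel with h | h | h | h | h <;> grind

/-- Every consistent atomic RCC8 network over {DC, TPP, TPP⁻¹, NTPP, NTPP⁻¹}
has a convex solution in ℝ². -/
theorem statement7 (m d : ℕ) (A : Fin m → Set (EuclideanSpace ℝ (Fin d)))
    (hA : ∀ i, (A i).Nonempty ∧ RegClosed (A i))
    (hrel : ∀ i j : Fin m, i ≠ j →
      DC (A i) (A j) ∨ TPP (A i) (A j) ∨ TPP (A j) (A i) ∨
      NTPP (A i) (A j) ∨ NTPP (A j) (A i)) :
    ∃ B : Fin m → Set (EuclideanSpace ℝ (Fin 2)),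
      (∀ i, (B i).Nonempty ∧ Convex ℝ (B i) ∧ RegClosed (B i)) ∧
      (∀ i j : Fin m, i ≠ j →
        (DC (B i) (B j) ↔ DC (A i) (A j)) ∧
        (TPP (B i) (B j) ↔ TPP (A i) (A j)) ∧
        (NTPP (B i) (B j) ↔ NTPP (A i) (A j))) := by
  classical
  have hpp : ∀ i j, NTPP (A i) (A j) → A i ⊂ A j := fun i j h =>
    (h.1.trans interior_subset).ssubset_of_ne h.2
  have hlam : ∀ i j, i ≠ j → A i ∩ A j = ∅ ∨ A i ⊂ A j ∨ A j ⊂ A i := by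
    intro i j hij
    rcases hrel i j hij with h | h | h | h | h
    · exact Or.inl h
    · exact Or.inr (Or.inl h.1)
    · exact Or.inr (Or.inr h.1)
    · exact Or.inr (Or.inl (hpp _ _ h))
    · exact Or.inr (Or.inr (hpp _ _ h))
  obtain ⟨l, r, hlr, hsub, hdis⟩ :=
    exists_intervals_of_laminar A (fun i => (hA i).1) hlam Finset.univ
  simp only [Finset.mem_univ, true_imp_iff] at hlr hsub hdis
  have hinj : Function.Injective l := by
    intro i j h
    by_contra hij
    rcases hlam i j hij with h' | h' | h'
    · rcases hdis i j h' with h' | h'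
      · linarith [hlr i]
      · linarith [hlr j]
    · linarith [hsub i j h']
    · linarith [hsub j i h']
  obtain ⟨ε, hε, hgap⟩ := exists_pos_mul_le_sq_sub hinj (2 * m + 2)
  obtain ⟨C, hC⟩ : ∃ C, ∀ i, l i ^ 2 ≤ C ∧ r i ^ 2 ≤ C := by
    obtain ⟨C₁, h₁⟩ := (Set.finite_range fun i => l i ^ 2).bddAbove
    obtain ⟨C₂, h₂⟩ := (Set.finite_range fun i => r i ^ 2).bddAbove
    exact ⟨max C₁ C₂, fun i => ⟨(h₁ ⟨i, rfl⟩).trans (le_max_left _ _),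
      (h₂ ⟨i, rfl⟩).trans (le_max_right _ _)⟩⟩
  let D : Fin m → ℝ := fun i => C + 1 + (Finset.univ.filter fun j => A j ⊂ A i).card
  have hD : ∀ i, C < D i := fun i => by
    have : (0 : ℝ) ≤ (Finset.univ.filter fun j => A j ⊂ A i).card := Nat.cast_nonneg _
    simp only [D]; linarith
  have hDlt : ∀ i j, A i ⊂ A j → D i < D j := by
    intro i j hij
    simp only [D, add_lt_add_iff_left, Nat.cast_lt]
    apply Finset.card_lt_card
    refine Finset.ssubset_iff_of_subset (fun k => ?_) |>.2 ⟨i, ?_, ?_⟩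
    · simpa using fun h => h.trans hij
    · simpa using hij
    · simp
  let c : Fin m → Fin m → ℝ := fun k e => ε * (supportRank A k e + 1)
  let B : Fin m → Set (EuclideanSpace ℝ (Fin 2)) := fun i => polygon l (l i) (r i) (D i) (c i)
  have hcpos : ∀ k e, 0 < c k e := fun k e => by positivity
  have hcle : ∀ k e, c k e ≤ ε * (2 * m + 2) := by
    intro k e
    have h : ((supportRank A k e : ℕ) : ℝ) ≤ ((2 * Fintype.card (Fin m) + 1 : ℕ) : ℝ) :=
      Nat.cast_le.2 (supportRank_le A k e)
    push_cast [Fintype.card_fin] at h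
    exact mul_le_mul_of_nonneg_left (by linarith) hε.le
  have hne : ∀ i, (openPolygon l (l i) (r i) (D i) (c i)).Nonempty := fun i =>
    openPolygon_nonempty (hlr i) ((hC i).1.trans_lt (hD i)) ((hC i).2.trans_lt (hD i)) (hcpos i)
  have htouch : ∀ i, !₂[l i, l i ^ 2 - c i i] ∈ B i := fun i =>
    touchPoint_mem_polygon le_rfl (hlr i).le ((hC i).1.trans (hD i).le) (fun e => (hcpos i e).le)
      fun e he => (hcle i i).trans (hgap e i he)
  have hBne : ∀ i, (B i).Nonempty := fun i => ⟨_, htouch i⟩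
  have hBnot : ∀ i j, A i ⊂ A j → ¬ B j ⊆ B i := by
    intro i j hij h
    have h1 := (h (htouch j)).1
    simp at h1
    linarith [hsub i j hij]
  have hDC : ∀ i j, DC (A i) (A j) → DC (B i) (B j) := by
    intro i j h
    refine Set.eq_empty_iff_forall_notMem.2 fun z ⟨hz, hz'⟩ => ?_
    rcases hdis i j h with h | h
    · linarith [hz.2.1, hz'.1]
    · linarith [hz.1, hz'.2.1]
  have hT : ∀ i j, TPP (A i) (A j) → TPP (B i) (B j) := by
    intro i j h
    obtain ⟨h1, h2⟩ := hsub i j h.1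
    refine ⟨⟨polygon_mono h1.le h2.le (hDlt i j h.1).le fun e => ?_, hBnot i j h.1⟩, fun hs => ?_⟩
    · have := supportRank_mono A h.1.1 e
      simp only [c]
      gcongr
    · have hc : c i i = c j i := by simp only [c, supportRank_eq A h.1.1 h.2]
      have := hs (htouch i)
      rw [hc] at this
      exact touchPoint_notMem_interior this
  have hN : ∀ i j, NTPP (A i) (A j) → NTPP (B i) (B j) := by
    intro i j h
    have hij := hpp i j h
    obtain ⟨h1, h2⟩ := hsub i j hij
    refine ⟨(polygon_subset_openPolygon h1 h2 (hDlt i j hij) fun e => ?_).trans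
      openPolygon_subset_interior, fun heq => hBnot i j hij heq.ge⟩
    have := supportRank_lt A hij h.1 e
    simp only [c]
    gcongr
  exact ⟨B, fun i => ⟨hBne i, convex_polygon, regClosed_polygon (hne i)⟩, fun i j hij =>
    rcc_iff_of_imp (hBne i) (hBne j) (hrel i j hij) (hDC i j) (hT i j) (hT j i) (hN i j) (hN j i)⟩
end

section
/- Let A : Fin m → Set (ℝ^d) be a family of nonempty regular closed subsets of a Euclidean space ℝ^d such that for all i ≠ j one of PO(A i, A j), TPP(A i, A j), TPP(A j, A i), NTPP(A i, A j), NTPP(A j, A i) holds. Then there exists a family B : Fin m → Set ℝ² of nonempty convex regular closed subsets of ℝ² such that for all i ≠ j, PO(B i, B j) holds iff PO(A i, A j) holds, TPP(B i, B j) holds iff TPP(A i, A j) holds, and NTPP(B i, B j) holds iff NTPP(A i, A j) holds. (Every consistent atomic RCC8 network over {PO, TPP, TPP⁻¹, NTPP, NTPP⁻¹} has a convex solution in ℝ².) -/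
open scoped Classical in
/-- The depth of a point in a set: `0` outside, `1` on the part of the set outside its interior,
`2` in the interior. -/
noncomputable def pointDepth {X : Type*} [TopologicalSpace X] (x : X) (S : Set X) : ℕ :=
  if x ∈ interior S then 2 else if x ∈ S then 1 else 0

/-- The number of members of a finite family that are proper subsets of a given member. -/
noncomputable def properSubsetRank {X ι : Type*} (A : ι → Set X) (i : ι) : ℕ :=
  Set.ncard {k | A k ⊂ A i}

lemma properSubsetRank_lt {X ι : Type*} [Finite ι] {A : ι → Set X} {i j : ι} (h : A i ⊂ A j) :
    properSubsetRank A i < properSubsetRank A j := by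
  refine Set.ncard_lt_ncard ?_ (Set.toFinite _)
  refine (Set.ssubset_iff_of_subset fun k (hk : A k ⊂ A i) => hk.trans h).2 ⟨i, h, ?_⟩
  exact fun (hi : A i ⊂ A i) => ssubset_irrefl _ hi

lemma properSubsetRank_lt_card {X ι : Type*} [Finite ι] (A : ι → Set X) (i : ι) :
    properSubsetRank A i < Nat.card ι := by
  rw [← Set.ncard_univ]
  refine Set.ncard_lt_ncard ?_ (Set.toFinite _)
  refine (Set.ssubset_iff_of_subset (Set.subset_univ _)).2 ⟨i, Set.mem_univ i, ?_⟩
  exact fun (hi : A i ⊂ A i) => ssubset_irrefl _ hi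

/-- Depth of a point, refined by the rank in the inclusion order away from the boundary. -/
noncomputable def refinedDepth {X ι : Type*} [TopologicalSpace X] (A : ι → Set X) (x : X)
    (i : ι) : ℕ :=
  Nat.card ι * pointDepth x (A i) + if pointDepth x (A i) = 1 then 0 else properSubsetRank A i

lemma refinedDepth_lt_of_pointDepth_lt {X ι : Type*} [TopologicalSpace X] [Finite ι]
    (A : ι → Set X) (x : X) {i j : ι} (h : pointDepth x (A i) < pointDepth x (A j)) :
    refinedDepth A x i < refinedDepth A x j := by
  have h1 := properSubsetRank_lt_card A i
  have h2 := Nat.mul_le_mul_left (Nat.card ι) (Nat.succ_le_of_lt h)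
  rw [Nat.succ_eq_add_one, mul_add, mul_one] at h2
  unfold refinedDepth
  split_ifs <;> omega

lemma refinedDepth_lt {X ι : Type*} [TopologicalSpace X] [Finite ι]
    (A : ι → Set X) (x : X) (i : ι) : refinedDepth A x i < 3 * Nat.card ι := by
  have h1 := properSubsetRank_lt_card A i
  have h2 : pointDepth x (A i) ≤ 2 := by unfold pointDepth; split_ifs <;> omega
  have h3 := Nat.mul_le_mul_left (Nat.card ι) h2
  unfold refinedDepth
  split_ifs <;> omega

lemma pointDepth_mono {X : Type*} [TopologicalSpace X] (x : X) {S T : Set X} (h : S ⊆ T) :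
    pointDepth x S ≤ pointDepth x T := by
  have h1 := @interior_mono _ _ _ _ h x
  have h2 := @h x
  unfold pointDepth
  split_ifs <;> simp_all

lemma refinedDepth_mono {X ι : Type*} [TopologicalSpace X] [Finite ι]
    {A : ι → Set X} (hA : Function.Injective A) (x : X) {i j : ι} (h : A i ⊆ A j) :
    refinedDepth A x i ≤ refinedDepth A x j := by
  rcases eq_or_ne i j with rfl | hij
  · rfl
  have hr := properSubsetRank_lt (h.ssubset_of_ne (hA.ne hij))
  rcases (pointDepth_mono x h).lt_or_eq with hd | hd
  · exact (refinedDepth_lt_of_pointDepth_lt A x hd).le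
  · unfold refinedDepth
    rw [hd]
    split_ifs <;> omega

lemma refinedDepth_strictMono {X ι : Type*} [TopologicalSpace X] [Finite ι]
    {A : ι → Set X} (hA : Function.Injective A) (x : X) {i j : ι} (hij : i ≠ j)
    (h : A i ⊆ interior (A j)) : refinedDepth A x i < refinedDepth A x j := by
  have h' := h.trans interior_subset
  have hr := properSubsetRank_lt (h'.ssubset_of_ne (hA.ne hij))
  rcases (pointDepth_mono x h').lt_or_eq with hd | hd
  · exact refinedDepth_lt_of_pointDepth_lt A x hd
  · have h1 : pointDepth x (A i) ≠ 1 := by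
      intro h1
      have h2 := hd.symm.trans h1
      have hx := @h x
      unfold pointDepth at h1 h2
      split_ifs at h1 h2 <;> simp_all
    unfold refinedDepth
    rw [← hd, if_neg h1, if_neg h1]
    omega

/-- A finite family of distinct sets has finitely many real-valued profiles which encode inclusion
by `≤` and inclusion into the interior by `<`. -/
lemma exists_inclusion_profile {X ι : Type*} [TopologicalSpace X] [Nonempty X] [Finite ι]
    {A : ι → Set X} (hA : Function.Injective A) :
    ∃ g : ι × ι → ι → ℝ, (∀ k i, 0 ≤ g k i ∧ g k i < 1) ∧
      ∀ i j, i ≠ j → (A i ⊆ A j ↔ ∀ k, g k i ≤ g k j) ∧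
        (A i ⊆ interior (A j) ↔ ∀ k, g k i < g k j) := by
  have hx : ∀ k : ι × ι, ∃ x : X, (¬ A k.1 ⊆ A k.2 → x ∈ A k.1 ∧ x ∉ A k.2) ∧
      (¬ A k.1 ⊆ interior (A k.2) → x ∈ A k.1 ∧ x ∉ interior (A k.2)) := by
    intro k
    by_cases h : A k.1 ⊆ A k.2
    · by_cases h' : A k.1 ⊆ interior (A k.2)
      · exact ⟨Classical.arbitrary X, fun hn => absurd h hn, fun hn => absurd h' hn⟩
      · obtain ⟨x, hx⟩ := Set.not_subset.1 h'
        exact ⟨x, fun hn => absurd h hn, fun _ => hx⟩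
    · obtain ⟨x, hx⟩ := Set.not_subset.1 h
      exact ⟨x, fun _ => hx, fun _ => ⟨hx.1, fun hi => hx.2 (interior_subset hi)⟩⟩
  choose x hx1 hx2 using hx
  refine ⟨fun k i => (refinedDepth A (x k) i : ℝ) / (3 * Nat.card ι : ℕ), ?_, ?_⟩
  · intro k i
    have h := refinedDepth_lt A (x k) i
    refine ⟨by positivity, ?_⟩
    rw [div_lt_one (by exact_mod_cast (Nat.zero_le _).trans_lt h)]
    exact_mod_cast h
  · intro i j hij
    have hpos : (0 : ℝ) < (3 * Nat.card ι : ℕ) := by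
      exact_mod_cast (Nat.zero_le _).trans_lt (refinedDepth_lt A (x (i, i)) i)
    simp only [div_le_div_iff_of_pos_right hpos, div_lt_div_iff_of_pos_right hpos, Nat.cast_le,
      Nat.cast_lt]
    refine ⟨⟨fun h k => refinedDepth_mono hA (x k) h, fun h => ?_⟩,
      ⟨fun h k => refinedDepth_strictMono hA (x k) hij h, fun h => ?_⟩⟩
    · by_contra hn
      obtain ⟨hi, hj⟩ := hx1 (i, j) hn
      refine (h (i, j)).not_gt (refinedDepth_lt_of_pointDepth_lt A _ ?_)
      have hj' : x (i, j) ∉ interior (A j) := fun h' => hj (interior_subset h')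
      unfold pointDepth
      rw [if_neg hj', if_neg hj]
      split_ifs <;> simp_all
    · by_contra hn
      obtain ⟨hi, hj⟩ := hx2 (i, j) hn
      by_cases hj' : x (i, j) ∈ A j
      · have hdj : pointDepth (x (i, j)) (A j) = 1 := by simp_all [pointDepth]
        rcases Nat.lt_or_ge 1 (pointDepth (x (i, j)) (A i)) with hd | hd
        · exact (h (i, j)).not_gt (refinedDepth_lt_of_pointDepth_lt A _ (hdj ▸ hd))
        · have hdi : pointDepth (x (i, j)) (A i) = 1 := by
            refine le_antisymm hd ?_
            unfold pointDepth
            split_ifs <;> simp_all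
          have := h (i, j)
          simp [refinedDepth, hdi, hdj] at this
      · refine (h (i, j)).not_gt (refinedDepth_lt_of_pointDepth_lt A _ ?_)
        unfold pointDepth
        rw [if_neg hj, if_neg hj']
        split_ifs <;> simp_all

/-- The region above the shifted tangent lines `y = 2 tₖ x - tₖ² - cₖ` of the parabola `y = x²`. -/
def tangentRegion {κ : Type*} (t c : κ → ℝ) : Set (EuclideanSpace ℝ (Fin 2)) :=
  {p | ∀ k, 2 * t k * p 0 - t k ^ 2 - c k ≤ p 1}

lemma convex_tangentRegion {κ : Type*} (t c : κ → ℝ) : Convex ℝ (tangentRegion t c) := by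
  intro p hp q hq a b ha hb hab k
  have h1 := mul_le_mul_of_nonneg_left (hp k) ha
  have h2 := mul_le_mul_of_nonneg_left (hq k) hb
  obtain rfl : b = 1 - a := by linarith
  simp only [PiLp.add_apply, PiLp.smul_apply, smul_eq_mul]
  nlinarith

lemma isClosed_tangentRegion {κ : Type*} (t c : κ → ℝ) : IsClosed (tangentRegion t c) := by
  simp only [tangentRegion, Set.ofPred_forall]
  exact isClosed_iInter fun k => isClosed_le (by fun_prop) (by fun_prop)

lemma tendsto_vertical_shift (p : EuclideanSpace ℝ (Fin 2)) :
    Filter.Tendsto (fun n : ℝ => p + n • EuclideanSpace.single 1 (1 : ℝ)) (nhds 0) (nhds p) := by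
  have h : Continuous fun n : ℝ => p + n • EuclideanSpace.single (1 : Fin 2) (1 : ℝ) := by fun_prop
  simpa using h.tendsto 0

lemma interior_tangentRegion {κ : Type*} [Finite κ] (t c : κ → ℝ) :
    interior (tangentRegion t c) = {p | ∀ k, 2 * t k * p 0 - t k ^ 2 - c k < p 1} := by
  apply subset_antisymm
  · intro p hp k
    have h := ((tendsto_vertical_shift p).eventually (mem_interior_iff_mem_nhds.1 hp)).filter_mono
      (nhdsWithin_le_nhds (s := Set.Iio 0))
    obtain ⟨ε, hε, hneg⟩ := (h.and self_mem_nhdsWithin).exists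
    have := hε k
    simp at this hneg
    linarith
  · refine interior_maximal (fun p hp k => (hp k).le) ?_
    simp only [Set.ofPred_forall]
    exact isOpen_iInter_of_finite fun k => isOpen_lt (by fun_prop) (by fun_prop)

lemma regClosed_tangentRegion {κ : Type*} [Finite κ] (t c : κ → ℝ) :
    RegClosed (tangentRegion t c) := by
  refine subset_antisymm (closure_minimal interior_subset (isClosed_tangentRegion t c)) ?_
  intro p hp
  refine mem_closure_of_tendsto
    ((tendsto_vertical_shift p).mono_left (nhdsWithin_le_nhds (s := Set.Ioi 0))) ?_
  filter_upwards [self_mem_nhdsWithin] with ε hε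
  rw [interior_tangentRegion]
  intro k
  have := hp k
  simp at hε ⊢
  linarith

lemma nonempty_interior_inter_tangentRegion {κ : Type*} [Finite κ] (t c c' : κ → ℝ) :
    (interior (tangentRegion t c) ∩ interior (tangentRegion t c')).Nonempty := by
  obtain ⟨M, hM⟩ := (Set.finite_range fun k => - t k ^ 2 - c k).bddAbove
  obtain ⟨M', hM'⟩ := (Set.finite_range fun k => - t k ^ 2 - c' k).bddAbove
  refine ⟨!₂[0, max M M' + 1], ?_⟩
  rw [interior_tangentRegion, interior_tangentRegion]
  refine ⟨fun k => ?_, fun k => ?_⟩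
  · have h1 : -t k ^ 2 - c k ≤ M := hM (Set.mem_range_self k)
    have h2 := le_max_left M M'
    simp only [Matrix.cons_val_zero, Matrix.cons_val_one]
    linarith
  · have h1 : -t k ^ 2 - c' k ≤ M' := hM' (Set.mem_range_self k)
    have h2 := le_max_right M M'
    simp only [Matrix.cons_val_zero, Matrix.cons_val_one]
    linarith

/-- The point above `tₖ` on the lower boundary of a region with well-separated tangents. -/
lemma mem_tangentRegion_at {κ : Type*} {t c : κ → ℝ}
    (ht : ∀ k l, k ≠ l → 1 ≤ (t k - t l) ^ 2) (hc : ∀ k, 0 ≤ c k ∧ c k < 1) (k : κ) :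
    !₂[t k, t k ^ 2 - c k] ∈ tangentRegion t c := by
  intro l
  simp only [Matrix.cons_val_zero, Matrix.cons_val_one]
  rcases eq_or_ne k l with rfl | hkl
  · simp
    nlinarith
  · have := ht k l hkl
    have := hc k
    have := hc l
    simp
    nlinarith

lemma tangentRegion_subset_iff {κ : Type*} {t c c' : κ → ℝ}
    (ht : ∀ k l, k ≠ l → 1 ≤ (t k - t l) ^ 2) (hc : ∀ k, 0 ≤ c k ∧ c k < 1) :
    tangentRegion t c ⊆ tangentRegion t c' ↔ ∀ k, c k ≤ c' k := by
  refine ⟨fun h k => ?_, fun h p hp k => ?_⟩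
  · have := h (mem_tangentRegion_at ht hc k) k
    simp at this
    nlinarith
  · linarith [hp k, h k]

lemma tangentRegion_subset_interior_iff {κ : Type*} [Finite κ] {t c c' : κ → ℝ}
    (ht : ∀ k l, k ≠ l → 1 ≤ (t k - t l) ^ 2) (hc : ∀ k, 0 ≤ c k ∧ c k < 1) :
    tangentRegion t c ⊆ interior (tangentRegion t c') ↔ ∀ k, c k < c' k := by
  rw [interior_tangentRegion]
  refine ⟨fun h k => ?_, fun h p hp k => ?_⟩
  · have := h (mem_tangentRegion_at ht hc k) k
    simp at this
    nlinarith
  · linarith [hp k, h k]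

lemma exists_separated_reals (κ : Type*) [Finite κ] :
    ∃ t : κ → ℝ, ∀ k l, k ≠ l → 1 ≤ (t k - t l) ^ 2 := by
  refine ⟨fun k => ((Finite.equivFin κ k : ℕ) : ℤ), fun k l hkl => ?_⟩
  have h : ((Finite.equivFin κ k : ℕ) : ℤ) - (Finite.equivFin κ l : ℕ) ≠ 0 := by
    intro h
    exact hkl ((Finite.equivFin κ).injective (Fin.ext (by omega)))
  have := Int.one_le_abs h
  have h2 : (1 : ℤ) ≤ (((Finite.equivFin κ k : ℕ) : ℤ) - (Finite.equivFin κ l : ℕ)) ^ 2 := by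
    rw [← sq_abs]
    nlinarith
  have h3 : (1 : ℝ) ≤
      ((((Finite.equivFin κ k : ℕ) : ℤ) - (Finite.equivFin κ l : ℕ) : ℤ) : ℝ) ^ 2 := by
    exact_mod_cast h2
  simpa using h3

/-- Every consistent atomic RCC8 network over {PO, TPP, TPP⁻¹, NTPP, NTPP⁻¹}
has a convex solution in ℝ². -/
theorem statement8 (m d : ℕ) (A : Fin m → Set (EuclideanSpace ℝ (Fin d)))
    (hA : ∀ i, (A i).Nonempty ∧ RegClosed (A i))
    (hrel : ∀ i j : Fin m, i ≠ j →
      PO (A i) (A j) ∨ TPP (A i) (A j) ∨ TPP (A j) (A i) ∨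
      NTPP (A i) (A j) ∨ NTPP (A j) (A i)) :
    ∃ B : Fin m → Set (EuclideanSpace ℝ (Fin 2)),
      (∀ i, (B i).Nonempty ∧ Convex ℝ (B i) ∧ RegClosed (B i)) ∧
      (∀ i j : Fin m, i ≠ j →
        (PO (B i) (B j) ↔ PO (A i) (A j)) ∧
        (TPP (B i) (B j) ↔ TPP (A i) (A j)) ∧
        (NTPP (B i) (B j) ↔ NTPP (A i) (A j))) := by
  have hinj : Function.Injective A := by
    intro i j h
    by_contra hij
    rcases hrel i j hij with h' | h' | h' | h' | h'
    · exact h'.2.1 h.le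
    · exact h'.1.ne h
    · exact h'.1.ne h.symm
    · exact h'.2 h
    · exact h'.2 h.symm
  obtain ⟨g, hg, hgA⟩ := exists_inclusion_profile hinj
  obtain ⟨t, ht⟩ := exists_separated_reals (Fin m × Fin m)
  have hsub : ∀ i j, i ≠ j → (tangentRegion t (g · i) ⊆ tangentRegion t (g · j) ↔ A i ⊆ A j) :=
    fun i j hij => (tangentRegion_subset_iff ht fun k => hg k i).trans (hgA i j hij).1.symm
  have hint : ∀ i j, i ≠ j →
      (tangentRegion t (g · i) ⊆ interior (tangentRegion t (g · j)) ↔ A i ⊆ interior (A j)) :=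
    fun i j hij =>
      (tangentRegion_subset_interior_iff ht fun k => hg k i).trans (hgA i j hij).2.symm
  refine ⟨fun i => tangentRegion t (g · i), fun i => ⟨?_, convex_tangentRegion _ _,
    regClosed_tangentRegion _ _⟩, fun i j hij => ?_⟩
  · exact (nonempty_interior_inter_tangentRegion t (g · i) (g · i)).mono
      fun p hp => interior_subset hp.1
  have hne : tangentRegion t (g · i) ≠ tangentRegion t (g · j) := fun h => hij <| hinj <|
    subset_antisymm ((hsub i j hij).1 h.le) ((hsub j i hij.symm).1 h.ge)
  refine ⟨⟨fun h => ?_, fun h => ⟨nonempty_interior_inter_tangentRegion _ _ _, ?_, ?_⟩⟩, ?_, ?_⟩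
  · have h1 := mt (hsub i j hij).2 h.2.1
    have h2 := mt (hsub j i hij.symm).2 h.2.2
    rcases hrel i j hij with h' | h' | h' | h' | h'
    · exact h'
    · exact absurd h'.1.subset h1
    · exact absurd h'.1.subset h2
    · exact absurd (h'.1.trans interior_subset) h1
    · exact absurd (h'.1.trans interior_subset) h2
  · exact mt (hsub i j hij).1 h.2.1
  · exact mt (hsub j i hij.symm).1 h.2.2
  · simp only [TPP, ssubset_iff_subset_not_subset, hsub i j hij, hsub j i hij.symm, hint i j hij]
  · simp only [NTPP, hint i j hij, ne_eq, hne, hinj.eq_iff, hij]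
end

section
/- Let A : Fin m → Set (ℝ^d) be a family of nonempty regular closed subsets of a Euclidean space ℝ^d such that for all i ≠ j one of EC(A i, A j), TPP(A i, A j), TPP(A j, A i), NTPP(A i, A j), NTPP(A j, A i) holds. Then there exists a family B : Fin m → Set ℝ² of nonempty convex regular closed subsets of ℝ² such that for all i ≠ j, EC(B i, B j) holds iff EC(A i, A j) holds, TPP(B i, B j) holds iff TPP(A i, A j) holds, and NTPP(B i, B j) holds iff NTPP(A i, A j) holds. (Every consistent atomic RCC8 network over {EC, TPP, TPP⁻¹, NTPP, NTPP⁻¹} has a convex solution in ℝ².) -/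
section Regions

variable {α : Type*} [TopologicalSpace α] {a b c x : Set α}

theorem RegClosed.interior_nonempty (hx : RegClosed x) (hne : x.Nonempty) :
    (interior x).Nonempty := by
  rw [← closure_nonempty_iff, hx]
  exact hne

theorem EC.symm (h : EC a b) : EC b a :=
  ⟨Set.inter_comm a b ▸ h.1, Set.inter_comm (interior a) (interior b) ▸ h.2⟩

theorem EC.not_subset_subset (h : EC a b) (hx : RegClosed x) (hne : x.Nonempty)
    (ha : x ⊆ a) : ¬ x ⊆ b := by
  intro hb
  obtain ⟨p, hp⟩ := hx.interior_nonempty hne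
  have hmem : p ∈ interior a ∩ interior b := ⟨interior_mono ha hp, interior_mono hb hp⟩
  rw [h.2] at hmem
  exact hmem

theorem NTPP.subset (h : NTPP a b) : a ⊆ b := h.1.trans interior_subset

theorem NTPP.not_superset (h : NTPP a b) : ¬ b ⊆ a :=
  fun hb => h.2 (h.subset.antisymm hb)

theorem NTPP.trans_subset (h : NTPP a b) (hbc : b ⊆ c) : NTPP a c :=
  ⟨h.1.trans (interior_mono hbc), fun e => h.not_superset (e ▸ hbc)⟩

theorem NTPP.subset_trans (hab : a ⊆ b) (h : NTPP b c) : NTPP a c :=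
  ⟨hab.trans h.1, fun e => h.not_superset (e ▸ hab)⟩

theorem TPP.not_NTPP (h : TPP a b) : ¬ NTPP a b := fun h' => h.2 h'.1

theorem EC.disjoint_interior (h : EC a b) (ha : RegClosed a) : Disjoint a (interior b) := by
  rw [← ha]
  exact (Set.disjoint_iff_inter_eq_empty.2 h.2).closure_left isOpen_interior

/-- Nonempty regular closed sets satisfying an implication from each of the five relations to
the corresponding one satisfy the corresponding equivalences, because the relations exclude
each other. -/
theorem relations_iff_of_imp {β : Type*} [TopologicalSpace β] {a' b' : Set β}
    (hne : a'.Nonempty) (hne' : b'.Nonempty) (hr : RegClosed a') (hr' : RegClosed b')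
    (hrel : EC a b ∨ TPP a b ∨ TPP b a ∨ NTPP a b ∨ NTPP b a)
    (hE : EC a b → EC a' b') (hT : TPP a b → TPP a' b') (hT' : TPP b a → TPP b' a')
    (hN : NTPP a b → NTPP a' b') (hN' : NTPP b a → NTPP b' a') :
    (EC a' b' ↔ EC a b) ∧ (TPP a' b' ↔ TPP a b) ∧ (NTPP a' b' ↔ NTPP a b) := by
  have e1 : EC a' b' → ¬ a' ⊆ b' := fun h => h.not_subset_subset hr hne subset_rfl
  have e2 : EC a' b' → ¬ b' ⊆ a' := fun h => h.symm.not_subset_subset hr' hne' subset_rfl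
  have t1 : TPP a' b' → a' ⊆ b' ∧ ¬ b' ⊆ a' := fun h => h.1
  have t2 : TPP b' a' → b' ⊆ a' ∧ ¬ a' ⊆ b' := fun h => h.1
  have n1 : NTPP a' b' → a' ⊆ b' ∧ ¬ b' ⊆ a' := fun h => ⟨h.subset, h.not_superset⟩
  have n2 : NTPP b' a' → b' ⊆ a' ∧ ¬ a' ⊆ b' := fun h => ⟨h.subset, h.not_superset⟩
  have x1 : TPP a' b' → ¬ NTPP a' b' := TPP.not_NTPP
  have E2 : EC a b → ¬ TPP a b ∧ ¬ NTPP a b :=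
    fun h => ⟨fun h' => e1 (hE h) (t1 (hT h')).1, fun h' => e1 (hE h) (n1 (hN h')).1⟩
  have T2 : TPP a b → ¬ NTPP a b := TPP.not_NTPP
  grind

end Regions

section Laminar

/-- A finite forest order embeds into the integer intervals ordered by inclusion, with
incomparable elements going to intervals without common interior. -/
theorem exists_laminar_intervals {α : Type*} [PartialOrder α] (s : Finset α)
    (hs : ∀ x ∈ s, ∀ a ∈ s, ∀ b ∈ s, x ≤ a → x ≤ b → a ≤ b ∨ b ≤ a) :
    ∃ lo hi : α → ℤ, (∀ a ∈ s, lo a < hi a) ∧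
      (∀ a ∈ s, ∀ b ∈ s, a < b → lo b < lo a ∧ hi a ≤ hi b) ∧
      (∀ a ∈ s, ∀ b ∈ s, ¬ a ≤ b → ¬ b ≤ a → hi a ≤ lo b ∨ hi b ≤ lo a) := by
  classical
  induction s using Finset.strongInduction with
  | H s ih =>
  rcases s.eq_empty_or_nonempty with rfl | hne
  · exact ⟨0, 0, by simp, by simp, by simp⟩
  obtain ⟨x, hxs, hmin⟩ := s.exists_minimal hne
  have hmin' : ∀ y ∈ s, ¬ y < x := fun y hy hlt => hlt.not_ge (hmin hy hlt.le)
  obtain ⟨lo, hi, h1, h2, h3⟩ := ih (s.erase x) (Finset.erase_ssubset hxs)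
    (fun y hy a ha b hb => hs y (Finset.mem_of_mem_erase hy) a (Finset.mem_of_mem_erase ha) b
      (Finset.mem_of_mem_erase hb))
  have key : ∃ φ : ℤ → ℤ, ∃ l h : ℤ, StrictMono φ ∧ l < h ∧
      (∀ b ∈ s.erase x, x < b → φ (lo b) < l ∧ h ≤ φ (hi b)) ∧
      (∀ b ∈ s.erase x, ¬ x ≤ b → h ≤ φ (lo b) ∨ φ (hi b) ≤ l) := by
    by_cases hp : ((s.erase x).filter (x < ·)).Nonempty
    · obtain ⟨p, hp, hpmin⟩ := Finset.exists_minimal hp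
      rw [Finset.mem_filter] at hp
      have hpe := hp.1
      have hps := Finset.mem_of_mem_erase hpe
      have hle : ∀ b ∈ s.erase x, x < b → p ≤ b := by
        intro b hb hxb
        rcases hs x hxs p hps b (Finset.mem_of_mem_erase hb) hp.2.le hxb.le with h | h
        · exact h
        · exact hpmin (Finset.mem_filter.2 ⟨hb, hxb⟩) h
      have hlp := h1 p hpe
      refine ⟨fun t => if t ≤ lo p then t else t + 2, lo p + 1, lo p + 2, ?_, by omega, ?_, ?_⟩
      · intro t u htu
        dsimp only
        split_ifs <;> omega
      · intro b hb hxb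
        have hb' : lo b ≤ lo p ∧ hi p ≤ hi b := by
          rcases (hle b hb hxb).eq_or_lt with rfl | h
          · exact ⟨le_rfl, le_rfl⟩
          · exact ⟨(h2 p hpe b hb h).1.le, (h2 p hpe b hb h).2⟩
        dsimp only
        split_ifs <;> omega
      · intro b hb hxb
        have hpb : ¬ p ≤ b := fun h => hxb (hp.2.le.trans h)
        have hlb := h1 b hb
        dsimp only
        by_cases hbp : b ≤ p
        · have := (h2 b hb p hpe (lt_of_le_not_ge hbp hpb)).1
          split_ifs <;> omega
        · have := h3 b hb p hpe hbp hpb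
          split_ifs <;> omega
    · rw [Finset.not_nonempty_iff_eq_empty, Finset.filter_eq_empty_iff] at hp
      obtain ⟨M, hM⟩ := ((s.erase x).image hi).bddAbove
      refine ⟨id, M, M + 1, strictMono_id, by omega, fun b hb h => absurd h (hp hb), ?_⟩
      intro b hb _
      exact Or.inr (hM (Finset.mem_coe.2 (Finset.mem_image_of_mem hi hb)))
  obtain ⟨φ, l, h, hφ, hlh, hup, hinc⟩ := key
  have hmem : ∀ a ∈ s, a ≠ x → a ∈ s.erase x := fun a ha hax => Finset.mem_erase.2 ⟨hax, ha⟩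
  refine ⟨Function.update (φ ∘ lo) x l, Function.update (φ ∘ hi) x h, ?_, ?_, ?_⟩
  · intro a ha
    by_cases hax : a = x
    · simpa [hax] using hlh
    · simpa [hax] using hφ (h1 a (hmem a ha hax))
  · intro a ha b hb hab
    by_cases hbx : b = x
    · exact absurd (hbx ▸ hab) (hmin' a ha)
    by_cases hax : a = x
    · subst hax
      simpa [hbx] using hup b (hmem b hb hbx) hab
    · have := h2 a (hmem a ha hax) b (hmem b hb hbx) hab
      simpa [hax, hbx] using (⟨hφ this.1, hφ.monotone this.2⟩ : _ ∧ _)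
  · intro a ha b hb hab hba
    by_cases hax : a = x
    · subst hax
      have hbx : b ≠ a := fun e => hab e.ge
      simpa [hbx] using hinc b (hmem b hb hbx) hab
    by_cases hbx : b = x
    · subst hbx
      simpa [hax] using (hinc a (hmem a ha hax) hba).symm
    · rcases h3 a (hmem a ha hax) b (hmem b hb hbx) hab hba with h | h
      · exact Or.inl (by simpa [hax, hbx] using hφ.monotone h)
      · exact Or.inr (by simpa [hax, hbx] using hφ.monotone h)

end Laminar

section Plane

/-- The linear functional `(x, y) ↦ a x + b y` on the plane. -/
noncomputable def planeForm (a b : ℝ) : EuclideanSpace ℝ (Fin 2) →L[ℝ] ℝ :=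
  a • EuclideanSpace.proj 0 + b • EuclideanSpace.proj 1

theorem planeForm_apply (a b : ℝ) (p : EuclideanSpace ℝ (Fin 2)) :
    planeForm a b p = a * p 0 + b * p 1 := by
  simp [planeForm]

theorem interior_planeForm_le {a b : ℝ} (h : a ≠ 0 ∨ b ≠ 0) (c : ℝ) :
    interior {p | planeForm a b p ≤ c} = {p | planeForm a b p < c} := by
  have hsurj : Function.Surjective (planeForm a b) := by
    have hpos : a * a + b * b ≠ 0 := by
      rcases h with h | h
      · have := mul_self_pos.2 h
        nlinarith [mul_self_nonneg b]
      · have := mul_self_pos.2 h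
        nlinarith [mul_self_nonneg a]
    intro t
    refine ⟨(t / (a * a + b * b)) • !₂[a, b], ?_⟩
    rw [map_smul, planeForm_apply]
    simp [hpos]
  have := (planeForm a b).interior_preimage hsurj (Set.Iic c)
  rwa [interior_Iic] at this

/-- The functional whose unit level line is tangent to the unit circle at the point of slope
parameter `t`. -/
noncomputable def circleForm (t : ℝ) : EuclideanSpace ℝ (Fin 2) →L[ℝ] ℝ :=
  planeForm (2 * t) (1 - t ^ 2)

/-- The point `r • (t, 1) / (1 + t ^ 2)`; for `r = 1` it lies on a fixed circle through the
origin. -/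
noncomputable def circlePoint (r t : ℝ) : EuclideanSpace ℝ (Fin 2) :=
  !₂[r * t / (1 + t ^ 2), r / (1 + t ^ 2)]

theorem circleForm_circlePoint (u r t : ℝ) :
    circleForm u (circlePoint r t) = r * (1 - (t - u) ^ 2 / (1 + t ^ 2)) := by
  have : 1 + t ^ 2 ≠ 0 := by positivity
  rw [circleForm, planeForm_apply]
  simp only [circlePoint, PiLp.toLp_apply, Matrix.cons_val_zero, Matrix.cons_val_one]
  field_simp
  ring

theorem interior_circleForm_le (t c : ℝ) :
    interior {p | circleForm t p ≤ c} = {p | circleForm t p < c} := by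
  apply interior_planeForm_le
  by_cases h : t = 0
  · simp [h]
  · simp [h]

/-- The wedge `l y ≤ x ≤ h y`. -/
def wedge (l h : ℝ) : Set (EuclideanSpace ℝ (Fin 2)) :=
  {p | planeForm (-1) l p ≤ 0} ∩ {p | planeForm 1 (-h) p ≤ 0}

theorem mem_wedge {l h : ℝ} {p : EuclideanSpace ℝ (Fin 2)} :
    p ∈ wedge l h ↔ l * p 1 ≤ p 0 ∧ p 0 ≤ h * p 1 := by
  simp only [wedge, Set.mem_inter_iff, Set.mem_ofPred_eq, planeForm_apply]
  constructor <;> rintro ⟨h1, h2⟩ <;> constructor <;> linarith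

theorem mem_interior_wedge {l h : ℝ} {p : EuclideanSpace ℝ (Fin 2)} :
    p ∈ interior (wedge l h) ↔ l * p 1 < p 0 ∧ p 0 < h * p 1 := by
  rw [wedge, interior_inter, interior_planeForm_le (by simp), interior_planeForm_le (by simp)]
  simp only [Set.mem_inter_iff, Set.mem_ofPred_eq, planeForm_apply]
  constructor <;> rintro ⟨h1, h2⟩ <;> constructor <;> linarith

variable {ι : Type*}

/-- The polygonal region cut out by the lines tangent to the circle at parameters `t e`,
pushed away by the factors `r e`. -/
def tangentPolygon (t r : ι → ℝ) : Set (EuclideanSpace ℝ (Fin 2)) :=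
  ⋂ e, {p | circleForm (t e) p ≤ r e}

theorem mem_tangentPolygon {t r : ι → ℝ} {p : EuclideanSpace ℝ (Fin 2)} :
    p ∈ tangentPolygon t r ↔ ∀ e, circleForm (t e) p ≤ r e := by
  simp [tangentPolygon]

theorem mem_interior_tangentPolygon [Finite ι] {t r : ι → ℝ} {p : EuclideanSpace ℝ (Fin 2)} :
    p ∈ interior (tangentPolygon t r) ↔ ∀ e, circleForm (t e) p < r e := by
  simp [tangentPolygon, interior_iInter_of_finite, interior_circleForm_le]

theorem convex_planeForm_le (a b c : ℝ) : Convex ℝ {p | planeForm a b p ≤ c} :=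
  convex_halfSpace_le (planeForm a b).toLinearMap.isLinear c

theorem isClosed_planeForm_le (a b c : ℝ) : IsClosed {p | planeForm a b p ≤ c} :=
  isClosed_le (planeForm a b).continuous continuous_const

theorem convex_wedge (l h : ℝ) : Convex ℝ (wedge l h) :=
  (convex_planeForm_le _ _ _).inter (convex_planeForm_le _ _ _)

theorem isClosed_wedge (l h : ℝ) : IsClosed (wedge l h) :=
  (isClosed_planeForm_le _ _ _).inter (isClosed_planeForm_le _ _ _)

theorem convex_tangentPolygon (t r : ι → ℝ) : Convex ℝ (tangentPolygon t r) :=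
  convex_iInter fun _ => convex_planeForm_le _ _ _

theorem isClosed_tangentPolygon (t r : ι → ℝ) : IsClosed (tangentPolygon t r) :=
  isClosed_iInter fun _ => isClosed_planeForm_le _ _ _

theorem regClosed_of_convex {s : Set (EuclideanSpace ℝ (Fin 2))} (hc : Convex ℝ s)
    (hcl : IsClosed s) (hne : (interior s).Nonempty) : RegClosed s := by
  rw [RegClosed, hc.closure_interior_eq_closure_of_nonempty_interior hne, hcl.closure_eq]

theorem interior_tangentPolygon_inter_wedge_nonempty [Finite ι] {t r : ι → ℝ} {l h : ℝ}
    (hr : ∀ e, 1 ≤ r e) (hlh : l < h) :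
    (interior (tangentPolygon t r ∩ wedge l h)).Nonempty := by
  refine ⟨circlePoint (1 / 2) ((l + h) / 2), ?_⟩
  rw [interior_inter]
  refine ⟨mem_interior_tangentPolygon.2 fun e => ?_, mem_interior_wedge.2 ?_⟩
  · rw [circleForm_circlePoint]
    have : 0 ≤ ((l + h) / 2 - t e) ^ 2 / (1 + ((l + h) / 2) ^ 2) := by positivity
    linarith [hr e]
  · simp only [circlePoint, PiLp.toLp_apply, Matrix.cons_val_zero, Matrix.cons_val_one]
    have hpos : 0 < 1 / 2 / (1 + ((l + h) / 2) ^ 2) := by positivity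
    rw [mul_div_right_comm]
    constructor <;> nlinarith

/-- Small enough dilations keep each tangency point on the inner side of the other tangents. -/
theorem exists_dilation_bound [Fintype ι] (k : ι → ℤ) (hk : Function.Injective k) (N : ℕ) :
    ∃ ε : ℝ, 0 < ε ∧ ∀ e f, e ≠ f → ∀ n : ℕ, n ≤ N →
      circleForm (k f) (circlePoint (1 + ε * n) (k e)) ≤ 1 := by
  set M : ℝ := 1 + ∑ e, (k e : ℝ) ^ 2 with hM
  have hM1 : 1 ≤ M := by
    have : 0 ≤ ∑ e, (k e : ℝ) ^ 2 := Finset.sum_nonneg fun _ _ => sq_nonneg _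
    linarith
  have hM0 : 0 < M := by linarith
  refine ⟨1 / ((N + 1) * M), by positivity, fun e f hef n hn => ?_⟩
  rw [circleForm_circlePoint]
  have hle : 1 + (k e : ℝ) ^ 2 ≤ M := by
    have := Finset.single_le_sum (f := fun e => (k e : ℝ) ^ 2) (fun _ _ => sq_nonneg _)
      (Finset.mem_univ e)
    linarith
  have hsq : (1 : ℝ) ≤ ((k e : ℝ) - k f) ^ 2 := by
    have h0 : k e - k f ≠ 0 := sub_ne_zero.2 (hk.ne hef)
    have : (1 : ℤ) ≤ (k e - k f) ^ 2 := by
      have := pow_pos (abs_pos.2 h0) 2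
      rw [sq_abs] at this
      omega
    exact_mod_cast this
  have hdiv : 1 / M ≤ ((k e : ℝ) - k f) ^ 2 / (1 + (k e : ℝ) ^ 2) := by
    gcongr
  have hn' : (n : ℝ) ≤ N + 1 := by
    have : (n : ℝ) ≤ N := by exact_mod_cast hn
    linarith
  have hε : 1 / ((N + 1) * M) * n ≤ 1 / M := by
    rw [div_mul_eq_mul_div, one_mul, div_le_div_iff₀ (by positivity) hM0]
    nlinarith
  have hε0 : 0 ≤ 1 / ((N + 1) * M) * n := by positivity
  have hMi : 0 < 1 / M := by positivity
  nlinarith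

end Plane

section Realization

variable {ι : Type*}

/-- Convex regions attached to the vertices of a forest: the vertices satisfying `free` get a
tangent polygon, the other ones the part of their polygon inside their wedge. -/
def convexModel (free : ι → Prop) (lo hi : ι → ℤ) (r : ι → ι → ℝ) (a : ι) :
    Set (EuclideanSpace ℝ (Fin 2)) :=
  tangentPolygon (fun e => (lo e : ℝ)) (r a) ∩ {p | ¬ free a → p ∈ wedge (lo a) (hi a)}

variable {free : ι → Prop} {lo hi : ι → ℤ} {r : ι → ι → ℝ} {a b : ι}

theorem convexModel_of_free (h : free a) :
    convexModel free lo hi r a = tangentPolygon (fun e => (lo e : ℝ)) (r a) := by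
  simp [convexModel, h]

theorem convexModel_of_not_free (h : ¬ free a) :
    convexModel free lo hi r a =
      tangentPolygon (fun e => (lo e : ℝ)) (r a) ∩ wedge (lo a) (hi a) := by
  simp [convexModel, h]

theorem convexModel_spec [Finite ι] (hr : ∀ e, 1 ≤ r a e) (hlh : lo a < hi a) :
    (convexModel free lo hi r a).Nonempty ∧ Convex ℝ (convexModel free lo hi r a) ∧
      RegClosed (convexModel free lo hi r a) := by
  have hne := interior_tangentPolygon_inter_wedge_nonempty (t := fun e => (lo e : ℝ)) hr
    (Int.cast_lt.2 hlh : (lo a : ℝ) < hi a)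
  have hne' : (interior (convexModel free lo hi r a)).Nonempty :=
    hne.mono (interior_mono fun p hp => ⟨hp.1, fun _ => hp.2⟩)
  have hconv : Convex ℝ (convexModel free lo hi r a) ∧
      IsClosed (convexModel free lo hi r a) := by
    by_cases h : free a
    · rw [convexModel_of_free h]
      exact ⟨convex_tangentPolygon _ _, isClosed_tangentPolygon _ _⟩
    · rw [convexModel_of_not_free h]
      exact ⟨(convex_tangentPolygon _ _).inter (convex_wedge _ _),
        (isClosed_tangentPolygon _ _).inter (isClosed_wedge _ _)⟩
  exact ⟨hne'.mono interior_subset, hconv.1, regClosed_of_convex hconv.1 hconv.2 hne'⟩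

theorem circlePoint_mem_convexModel (hlh : lo a < hi a) (hr : ∀ e, 1 ≤ r a e)
    (hd : ∀ e, e ≠ a → circleForm (lo e) (circlePoint (r a a) (lo a)) ≤ 1) :
    circlePoint (r a a) (lo a) ∈ convexModel free lo hi r a := by
  refine ⟨mem_tangentPolygon.2 fun e => ?_, fun _ => mem_wedge.2 ?_⟩
  · by_cases h : e = a
    · subst h
      simp [circleForm_circlePoint]
    · exact (hd e h).trans (hr e)
  · simp only [circlePoint, PiLp.toLp_apply, Matrix.cons_val_zero, Matrix.cons_val_one]
    have hpos : 0 < r a a / (1 + (lo a : ℝ) ^ 2) := by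
      have := hr a
      positivity
    have : (lo a : ℝ) < hi a := Int.cast_lt.2 hlh
    rw [mul_div_right_comm]
    constructor <;> nlinarith

theorem zero_mem_convexModel (hr : ∀ e, 1 ≤ r a e) : 0 ∈ convexModel free lo hi r a := by
  refine ⟨mem_tangentPolygon.2 fun e => ?_, fun _ => mem_wedge.2 (by simp)⟩
  rw [map_zero]
  linarith [hr e]

theorem zero_notMem_interior_convexModel (h : ¬ free a) :
    0 ∉ interior (convexModel free lo hi r a) := by
  rw [convexModel_of_not_free h, interior_inter]
  rintro ⟨-, hw⟩
  simpa using (mem_interior_wedge.1 hw).1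

theorem circleForm_lt_of_mem_interior_convexModel [Finite ι] {p : EuclideanSpace ℝ (Fin 2)}
    (hp : p ∈ interior (convexModel free lo hi r a)) (e : ι) :
    circleForm (lo e) p < r a e :=
  mem_interior_tangentPolygon.1 (interior_mono Set.inter_subset_left hp) e

theorem convexModel_subset (hla : lo a < hi a) (hr : ∀ e, r a e ≤ r b e)
    (hw : ¬ free b → ¬ free a ∧ lo b ≤ lo a ∧ hi a ≤ hi b) :
    convexModel free lo hi r a ⊆ convexModel free lo hi r b := by
  rintro p ⟨hp, hpw⟩
  refine ⟨mem_tangentPolygon.2 fun e => (mem_tangentPolygon.1 hp e).trans (hr e), fun hb => ?_⟩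
  obtain ⟨ha, hl, hh⟩ := hw hb
  have hpa := mem_wedge.1 (hpw ha)
  have hla' : (lo a : ℝ) < hi a := Int.cast_lt.2 hla
  have hl' : (lo b : ℝ) ≤ lo a := Int.cast_le.2 hl
  have hh' : (hi a : ℝ) ≤ hi b := Int.cast_le.2 hh
  have hy : 0 ≤ p 1 := by nlinarith
  exact mem_wedge.2 ⟨by nlinarith, by nlinarith⟩

theorem convexModel_subset_interior [Finite ι] (hr : ∀ e, r a e < r b e) (hb : free b) :
    convexModel free lo hi r a ⊆ interior (convexModel free lo hi r b) := by
  rintro p ⟨hp, -⟩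
  rw [convexModel_of_free hb]
  exact mem_interior_tangentPolygon.2 fun e => (mem_tangentPolygon.1 hp e).trans_lt (hr e)

theorem EC_convexModel (ha : ¬ free a) (hb : ¬ free b) (hra : ∀ e, 1 ≤ r a e)
    (hrb : ∀ e, 1 ≤ r b e) (hla : lo a < hi a)
    (h : hi a ≤ lo b ∨ hi b ≤ lo a) :
    EC (convexModel free lo hi r a) (convexModel free lo hi r b) := by
  refine ⟨⟨0, zero_mem_convexModel hra, zero_mem_convexModel hrb⟩, ?_⟩
  rw [Set.eq_empty_iff_forall_notMem]
  rintro p ⟨hpa, hpb⟩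
  rw [convexModel_of_not_free ha, interior_inter] at hpa
  rw [convexModel_of_not_free hb, interior_inter] at hpb
  obtain ⟨a1, a2⟩ := mem_interior_wedge.1 hpa.2
  obtain ⟨b1, b2⟩ := mem_interior_wedge.1 hpb.2
  have hla' : (lo a : ℝ) < hi a := Int.cast_lt.2 hla
  have hy : 0 < p 1 := by nlinarith
  rcases h with h | h
  · have h' : (hi a : ℝ) ≤ lo b := Int.cast_le.2 h
    nlinarith
  · have h' : (hi b : ℝ) ≤ lo a := Int.cast_le.2 h
    nlinarith

end Realization

section Network

variable {ι α : Type*} [TopologicalSpace α] {A : ι → Set α}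

/-- Every two members of the family are related by external connection or inclusion. -/
def IsContactForest (A : ι → Set α) : Prop :=
  (∀ i, (A i).Nonempty ∧ RegClosed (A i)) ∧
    ∀ i j, i ≠ j → EC (A i) (A j) ∨ TPP (A i) (A j) ∨ TPP (A j) (A i) ∨
      NTPP (A i) (A j) ∨ NTPP (A j) (A i)

/-- The members comparable with all other ones. -/
def IsCentral (A : ι → Set α) (i : ι) : Prop := ∀ j, A i ⊆ A j ∨ A j ⊆ A i

theorem IsContactForest.EC_of_not_subset (hA : IsContactForest A) {i j : ι}
    (h : ¬ A i ⊆ A j) (h' : ¬ A j ⊆ A i) : EC (A i) (A j) := by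
  rcases hA.2 i j (fun e => h (e ▸ subset_rfl)) with H | H | H | H | H
  · exact H
  · exact absurd H.1.1 h
  · exact absurd H.1.1 h'
  · exact absurd H.subset h
  · exact absurd H.subset h'

theorem IsContactForest.comparable (hA : IsContactForest A) {x i j : ι}
    (hi : A x ⊆ A i) (hj : A x ⊆ A j) : A i ⊆ A j ∨ A j ⊆ A i := by
  by_contra! h
  exact (hA.EC_of_not_subset h.1 h.2).not_subset_subset (hA.1 x).2 (hA.1 x).1 hi hj

theorem IsContactForest.injective (hA : IsContactForest A) : Function.Injective A := by
  intro i j hij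
  by_contra hne
  rcases hA.2 i j hne with H | H | H | H | H
  · exact H.not_subset_subset (hA.1 i).2 (hA.1 i).1 subset_rfl hij.le
  · exact H.1.ne hij
  · exact H.1.ne hij.symm
  · exact H.2 hij
  · exact H.2 hij.symm

theorem IsContactForest.isCentral_of_NTPP (hA : IsContactForest A) {i j : ι}
    (h : NTPP (A i) (A j)) : IsCentral A j := by
  intro k
  by_contra! hk
  have hdisj := ((hA.EC_of_not_subset hk.1 hk.2).symm.disjoint_interior (hA.1 k).2)
  by_cases hik : A i ⊆ A k
  · obtain ⟨p, hp⟩ := (hA.1 i).1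
    exact Set.disjoint_left.1 hdisj (hik hp) (h.1 hp)
  · obtain ⟨p, hp, hp'⟩ :=
      (hA.EC_of_not_subset hik (fun hki => hk.2 (hki.trans h.subset))).1
    exact Set.disjoint_left.1 hdisj hp' (h.1 hp)

theorem IsContactForest.isCentral_mono (hA : IsContactForest A) {i j : ι}
    (h : A i ⊆ A j) (hi : IsCentral A i) : IsCentral A j := by
  intro k
  rcases hi k with hk | hk
  · exact hA.comparable h hk
  · exact Or.inr (hk.trans h)

variable [Fintype ι]

open Classical in
/-- The central members that bound the extent of member `a` in direction `e`. -/
noncomputable def extentSet (A : ι → Set α) (a e : ι) : Finset ι :=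
  {d | IsCentral A d ∧ (A d ⊆ A a ∨ A e ⊆ A a ∧ A e ⊆ A d ∧ ¬ NTPP (A e) (A d))}

theorem mem_extentSet {a e d : ι} : d ∈ extentSet A a e ↔
    IsCentral A d ∧ (A d ⊆ A a ∨ A e ⊆ A a ∧ A e ⊆ A d ∧ ¬ NTPP (A e) (A d)) := by
  simp [extentSet]

theorem extentSet_mono {a b : ι} (h : A a ⊆ A b) (e : ι) :
    extentSet A a e ⊆ extentSet A b e := by
  intro d hd
  rw [mem_extentSet] at hd ⊢
  exact ⟨hd.1, hd.2.imp (fun h' => h'.trans h) fun h' => ⟨h'.1.trans h, h'.2⟩⟩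

theorem IsContactForest.extentSet_ssubset (hA : IsContactForest A) {a b : ι}
    (h : NTPP (A a) (A b)) (e : ι) : extentSet A a e ⊂ extentSet A b e := by
  refine (extentSet_mono h.subset e).ssubset_of_mem_notMem (a := b)
    (mem_extentSet.2 ⟨hA.isCentral_of_NTPP h, Or.inl subset_rfl⟩) fun hb => ?_
  rcases (mem_extentSet.1 hb).2 with h' | h'
  · exact h.not_superset h'
  · exact h'.2.2 (NTPP.subset_trans h'.1 h)

theorem extentSet_ssubset_self {a b : ι} (h : A a ⊂ A b) (hb : IsCentral A b) :
    extentSet A a b ⊂ extentSet A b b := by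
  refine (extentSet_mono h.1 b).ssubset_of_mem_notMem (a := b)
    (mem_extentSet.2 ⟨hb, Or.inl subset_rfl⟩) fun hb' => ?_
  rcases (mem_extentSet.1 hb').2 with h' | h'
  · exact h.2 h'
  · exact h.2 h'.1

theorem extentSet_subset_of_TPP {a b : ι} (h : TPP (A a) (A b)) :
    extentSet A b a ⊆ extentSet A a a := by
  intro d hd
  rw [mem_extentSet] at hd ⊢
  refine ⟨hd.1, ?_⟩
  rcases hd.1 a with hda | had
  · exact Or.inl hda
  · refine Or.inr ⟨subset_rfl, had, fun hN => ?_⟩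
    rcases hd.2 with hdb | hd'
    · exact h.not_NTPP (hN.trans_subset hdb)
    · exact hd'.2.2 hN

theorem IsContactForest.exists_convex (hA : IsContactForest A) :
    ∃ B : ι → Set (EuclideanSpace ℝ (Fin 2)),
      (∀ i, (B i).Nonempty ∧ Convex ℝ (B i) ∧ RegClosed (B i)) ∧
      ∀ i j, (EC (A i) (A j) → EC (B i) (B j)) ∧ (TPP (A i) (A j) → TPP (B i) (B j)) ∧
        (NTPP (A i) (A j) → NTPP (B i) (B j)) := by
  classical
  obtain ⟨lo', hi', h1, h2, h3⟩ := exists_laminar_intervals (Finset.univ.image A) (by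
    simp only [Finset.mem_image, Finset.mem_univ, true_and, forall_exists_index,
      forall_apply_eq_imp_iff]
    intro x i j
    exact hA.comparable)
  simp only [Finset.mem_image, Finset.mem_univ, true_and, forall_exists_index,
      forall_apply_eq_imp_iff] at h1 h2 h3
  set lo : ι → ℤ := fun i => lo' (A i)
  set hi : ι → ℤ := fun i => hi' (A i)
  have hinj : Function.Injective lo := by
    intro i j hij
    apply hA.injective
    have hi1 : lo i < hi i := h1 i
    have hj1 : lo j < hi j := h1 j
    by_cases hs : A i ⊆ A j
    · by_contra hne
      have : lo j < lo i := (h2 i j (lt_of_le_of_ne hs hne)).1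
      omega
    by_cases hs' : A j ⊆ A i
    · by_contra hne
      have : lo i < lo j := (h2 j i (lt_of_le_of_ne hs' (Ne.symm hne))).1
      omega
    have : hi i ≤ lo j ∨ hi j ≤ lo i := h3 i j hs hs'
    omega
  obtain ⟨ε, hε, hdil⟩ := exists_dilation_bound lo hinj (Fintype.card ι)
  set r : ι → ι → ℝ := fun a e => 1 + ε * (extentSet A a e).card with hrdef
  have hr : ∀ a e, 1 ≤ r a e := by
    intro a e
    have : 0 ≤ ε * (extentSet A a e).card := by positivity
    simpa [hrdef] using this
  have hrle : ∀ a b e f, extentSet A a e ⊆ extentSet A b f → r a e ≤ r b f := by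
    intro a b e f h
    have := Finset.card_le_card h
    simp only [hrdef]
    gcongr
  have hrlt : ∀ a b e f, extentSet A a e ⊂ extentSet A b f → r a e < r b f := by
    intro a b e f h
    have := Finset.card_lt_card h
    simp only [hrdef]
    gcongr
  have hpt : ∀ a, circlePoint (r a a) (lo a) ∈ convexModel (IsCentral A) lo hi r a := fun a =>
    circlePoint_mem_convexModel (h1 a) (hr a)
      fun e he => hdil a e he.symm _ (Finset.card_le_univ _)
  have hself : ∀ a, circleForm (lo a) (circlePoint (r a a) (lo a)) = r a a := by
    simp [circleForm_circlePoint]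
  have hsub : ∀ a b, A a ⊂ A b →
      convexModel (IsCentral A) lo hi r a ⊆ convexModel (IsCentral A) lo hi r b := by
    intro a b hab
    refine convexModel_subset (h1 a) (fun e => hrle _ _ _ _ (extentSet_mono hab.1 e)) fun hb => ?_
    exact ⟨fun ha => hb (hA.isCentral_mono hab.1 ha), (h2 a b hab).1.le, (h2 a b hab).2⟩
  refine ⟨convexModel (IsCentral A) lo hi r, fun a => convexModel_spec (hr a) (h1 a),
    fun a b => ⟨fun h => ?_, fun h => ?_, fun h => ?_⟩⟩
  · have hs := h.not_subset_subset (hA.1 a).2 (hA.1 a).1 subset_rfl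
    have hs' := h.symm.not_subset_subset (hA.1 b).2 (hA.1 b).1 subset_rfl
    exact EC_convexModel (fun ha => (ha b).elim hs hs') (fun hb => (hb a).elim hs' hs) (hr a)
      (hr b) (h1 a) (h3 a b hs hs')
  · refine ⟨⟨hsub a b h.1, fun hba => ?_⟩, fun hab => ?_⟩
    · have hmem := hba (hpt b)
      by_cases hb : IsCentral A b
      · have hle := mem_tangentPolygon.1 hmem.1 b
        rw [hself] at hle
        exact hle.not_gt (hrlt _ _ _ _ (extentSet_ssubset_self h.1 hb))
      · have hw := (mem_wedge.1 (hmem.2 fun ha => hb (hA.isCentral_mono h.1.1 ha))).1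
        have hlt : (lo b : ℝ) < lo a := Int.cast_lt.2 (h2 a b h.1).1
        simp only [circlePoint, PiLp.toLp_apply, Matrix.cons_val_zero, Matrix.cons_val_one] at hw
        rw [mul_div_right_comm] at hw
        have hpos : 0 < r b b / (1 + (lo b : ℝ) ^ 2) := by
          have := hr b b
          positivity
        nlinarith
    · by_cases hb : IsCentral A b
      · have hlt := circleForm_lt_of_mem_interior_convexModel (hab (hpt a)) a
        rw [hself] at hlt
        exact hlt.not_ge (hrle _ _ _ _ (extentSet_subset_of_TPP h))
      · exact zero_notMem_interior_convexModel hb (hab (zero_mem_convexModel (hr a)))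
  · have hint : convexModel (IsCentral A) lo hi r a ⊆
        interior (convexModel (IsCentral A) lo hi r b) :=
      convexModel_subset_interior (fun e => hrlt _ _ _ _ (hA.extentSet_ssubset h e))
        (hA.isCentral_of_NTPP h)
    refine ⟨hint, fun heq => ?_⟩
    have hlt := circleForm_lt_of_mem_interior_convexModel (hint (heq ▸ hpt b)) b
    rw [hself] at hlt
    exact lt_irrefl _ hlt

end Network

/-- Every consistent atomic RCC8 network over {EC, TPP, TPP⁻¹, NTPP, NTPP⁻¹}
has a convex solution in ℝ². -/
theorem statement9 (m d : ℕ) (A : Fin m → Set (EuclideanSpace ℝ (Fin d)))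
    (hA : ∀ i, (A i).Nonempty ∧ RegClosed (A i))
    (hrel : ∀ i j : Fin m, i ≠ j →
      EC (A i) (A j) ∨ TPP (A i) (A j) ∨ TPP (A j) (A i) ∨
      NTPP (A i) (A j) ∨ NTPP (A j) (A i)) :
    ∃ B : Fin m → Set (EuclideanSpace ℝ (Fin 2)),
      (∀ i, (B i).Nonempty ∧ Convex ℝ (B i) ∧ RegClosed (B i)) ∧
      (∀ i j : Fin m, i ≠ j →
        (EC (B i) (B j) ↔ EC (A i) (A j)) ∧
        (TPP (B i) (B j) ↔ TPP (A i) (A j)) ∧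
        (NTPP (B i) (B j) ↔ NTPP (A i) (A j))) := by
  obtain ⟨B, hB, h⟩ := IsContactForest.exists_convex (A := A) ⟨hA, hrel⟩
  exact ⟨B, hB, fun i j hij => relations_iff_of_imp (hB i).1 (hB j).1 (hB i).2.2 (hB j).2.2
    (hrel i j hij) (h i j).1 (h i j).2.1 (h j i).2.1 (h i j).2.2 (h j i).2.2⟩
end

section
/- Consider fifteen variables a, b, c, u, v, w, and r(x,y) for x ∈ {a,b,c} and y ∈ {u,v,w}, with constraints: PO(r(x,y), x) and PO(r(x,y), y) for each of the nine pairs (x,y), and DR between every other pair of distinct variables. There exist nonempty regular closed subsets of ℝ³ realizing all of these constraints, but there is no assignment of nonempty convex regular closed subsets of ℝ² satisfying all of them. (There is a consistent atomic RCC5 network over {DR, PO} with no convex solution in ℝ².) -/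
/-- The constraints of the RCC5 network from Proposition 12: nine regions `r i j`,
each partially overlapping `x i` and `y j`, with all other pairs of distinct
variables discrete from each other. -/
def Network10 {α : Type*} [TopologicalSpace α]
    (x y : Fin 3 → Set α) (r : Fin 3 → Fin 3 → Set α) : Prop :=
  (∀ i j, PO (r i j) (x i)) ∧
  (∀ i j, PO (r i j) (y j)) ∧
  (∀ i j, i ≠ j → DR (x i) (x j)) ∧
  (∀ i j, i ≠ j → DR (y i) (y j)) ∧
  (∀ i j, DR (x i) (y j)) ∧
  (∀ i j k l, (i, j) ≠ (k, l) → DR (r i j) (r k l)) ∧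
  (∀ i j k, k ≠ i → DR (r i j) (x k)) ∧
  (∀ i j k, k ≠ j → DR (r i j) (y k))

/-! ### Realization by unions of disjoint balls -/

/-- The union, over `n ∈ S`, of closed balls of radius `1/4` centred at `n • v`. -/
def ballUnion {E : Type*} [NormedAddCommGroup E] [NormedSpace ℝ E] (v : E) (S : Finset ℕ) :
    Set E :=
  ⋃ n ∈ S, Metric.closedBall ((n : ℝ) • v) (1 / 4)

section BallUnion

variable {E : Type*} [NormedAddCommGroup E] [NormedSpace ℝ E] {v : E} {S T : Finset ℕ}

theorem ball_subset_interior_ballUnion {n : ℕ} (hn : n ∈ S) :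
    Metric.ball ((n : ℝ) • v) (1 / 4) ⊆ interior (ballUnion v S) :=
  interior_maximal
    (Metric.ball_subset_closedBall.trans
      (Set.subset_biUnion_of_mem (u := fun n : ℕ => Metric.closedBall ((n : ℝ) • v) (1 / 4)) hn))
    Metric.isOpen_ball

theorem center_mem_interior_ballUnion {n : ℕ} (hn : n ∈ S) :
    (n : ℝ) • v ∈ interior (ballUnion v S) :=
  ball_subset_interior_ballUnion hn (Metric.mem_ball_self (by norm_num))

theorem regClosed_ballUnion : RegClosed (ballUnion v S) := by
  refine subset_antisymm (closure_minimal interior_subset ?_) ?_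
  · exact S.finite_toSet.isClosed_biUnion fun n _ => Metric.isClosed_closedBall
  · refine Set.iUnion₂_subset fun n hn => ?_
    rw [← closure_ball _ (by norm_num : (1 / 4 : ℝ) ≠ 0)]
    exact closure_mono (ball_subset_interior_ballUnion hn)

theorem disjoint_ballUnion (hv : ‖v‖ = 1) (h : Disjoint S T) :
    Disjoint (ballUnion v S) (ballUnion v T) := by
  simp only [ballUnion, Set.disjoint_iUnion_left, Set.disjoint_iUnion_right]
  intro n hn m hm
  refine Metric.closedBall_disjoint_closedBall ?_
  have hne : (n : ℤ) - m ≠ 0 := fun h' => by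
    have : n = m := by omega
    exact Finset.disjoint_left.1 h (this ▸ hm) hn
  rw [dist_eq_norm, ← sub_smul, norm_smul, hv, mul_one, Real.norm_eq_abs]
  have h1 : (1 : ℝ) ≤ |(n : ℝ) - m| := by
    exact_mod_cast Int.one_le_abs hne
  rw [abs_sub_comm] at h1
  linarith

theorem dr_ballUnion (hv : ‖v‖ = 1) (h : Disjoint S T) :
    DR (ballUnion v S) (ballUnion v T) :=
  Set.disjoint_iff_inter_eq_empty.1
    ((disjoint_ballUnion hv h).mono interior_subset interior_subset)

theorem not_ballUnion_subset (hv : ‖v‖ = 1) {n : ℕ} (hn : n ∈ S) (hn' : n ∉ T) :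
    ¬ ballUnion v S ⊆ ballUnion v T := fun h =>
  Set.disjoint_left.1 (disjoint_ballUnion hv (Finset.disjoint_singleton_left.2 hn'))
    (interior_subset (center_mem_interior_ballUnion (Finset.mem_singleton_self n)))
    (h (interior_subset (center_mem_interior_ballUnion hn)))

theorem po_ballUnion (hv : ‖v‖ = 1) (h : (S ∩ T).Nonempty) (hS : (S \ T).Nonempty)
    (hT : (T \ S).Nonempty) : PO (ballUnion v S) (ballUnion v T) := by
  obtain ⟨n, hn⟩ := h
  obtain ⟨k, hk⟩ := hS
  obtain ⟨l, hl⟩ := hT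
  rw [Finset.mem_inter] at hn
  rw [Finset.mem_sdiff] at hk hl
  exact ⟨⟨_, center_mem_interior_ballUnion hn.1, center_mem_interior_ballUnion hn.2⟩,
    not_ballUnion_subset hv hk.1 hk.2, not_ballUnion_subset hv hl.1 hl.2⟩

/-- Indices `< 9` are shared by `r i j` and `x i`, indices in `[9, 18)` by `r i j` and `y j`. -/
theorem exists_network10 (hv : ‖v‖ = 1) :
    ∃ (x y : Fin 3 → Set E) (r : Fin 3 → Fin 3 → Set E),
      (∀ i, (x i).Nonempty ∧ RegClosed (x i)) ∧
      (∀ i, (y i).Nonempty ∧ RegClosed (y i)) ∧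
      (∀ i j, (r i j).Nonempty ∧ RegClosed (r i j)) ∧
      Network10 x y r := by
  have good : ∀ {S : Finset ℕ}, S.Nonempty → (ballUnion v S).Nonempty ∧ RegClosed (ballUnion v S) :=
    fun ⟨_, hn⟩ => ⟨⟨_, interior_subset (center_mem_interior_ballUnion hn)⟩, regClosed_ballUnion⟩
  refine ⟨fun i => ballUnion v {3 * i.val, 3 * i.val + 1, 3 * i.val + 2},
    fun j => ballUnion v {9 + j.val, 12 + j.val, 15 + j.val},
    fun i j => ballUnion v {3 * i.val + j.val, 9 + 3 * i.val + j.val},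
    fun i => good (by simp), fun j => good (by simp), fun i j => good (by simp),
    fun i j => po_ballUnion hv ?_ ?_ ?_, fun i j => po_ballUnion hv ?_ ?_ ?_,
    fun i j h => dr_ballUnion hv ?_, fun i j h => dr_ballUnion hv ?_,
    fun i j => dr_ballUnion hv ?_, fun i j k l h => dr_ballUnion hv ?_,
    fun i j k h => dr_ballUnion hv ?_, fun i j k h => dr_ballUnion hv ?_⟩
  · exact ⟨3 * i.val + j.val, by simp; omega⟩
  · exact ⟨9 + 3 * i.val + j.val, by simp; omega⟩
  · obtain ⟨k, hk⟩ := exists_ne j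
    exact ⟨3 * i.val + k.val, by simp; omega⟩
  · exact ⟨9 + 3 * i.val + j.val, by simp; omega⟩
  · exact ⟨3 * i.val + j.val, by simp; omega⟩
  · obtain ⟨k, hk⟩ := exists_ne i
    exact ⟨9 + 3 * k.val + j.val, by simp; omega⟩
  all_goals
    try simp only [ne_eq, Prod.mk.injEq, Fin.ext_iff] at h
    simp
    omega

end BallUnion

/-! ### Angles subtended at a point -/

/-- The signed angle in `(-π, π]` under which the segment from `p` to `q` is seen from `u`. -/
noncomputable def subtended (p q u : ℂ) : ℝ := Complex.arg ((q - u) / (p - u))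

theorem arg_div_of_re_pos {z w : ℂ} (hz : 0 < z.re) (hw : 0 < w.re) :
    (z / w).arg = z.arg - w.arg := by
  have hz0 : z ≠ 0 := by rintro rfl; simp at hz
  have hw0 : w ≠ 0 := by rintro rfl; simp at hw
  have h1 := abs_lt.1 (Complex.abs_arg_lt_pi_div_two_iff.2 (Or.inl hz))
  have h2 := abs_lt.1 (Complex.abs_arg_lt_pi_div_two_iff.2 (Or.inl hw))
  rw [← Complex.arg_coe_angle_toReal_eq_arg, Complex.arg_div_coe_angle hz0 hw0,
    ← Real.Angle.coe_sub, Real.Angle.toReal_coe_eq_self_iff]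
  constructor <;> linarith

/-- The difference map `(a, b) ↦ b - a` on the product of two disjoint convex open sets has a
continuous argument, so its variation along the boundary of a rectangle vanishes. -/
theorem subtended_rectangle {A B : Set ℂ} (hA : Convex ℝ A) (hAo : IsOpen A) (hB : Convex ℝ B)
    (hBo : IsOpen B) (hAB : Disjoint A B) {p q u v : ℂ} (hp : p ∈ A) (hq : q ∈ A) (hu : u ∈ B)
    (hv : v ∈ B) :
    subtended p q u + subtended u v q = subtended p q v + subtended u v p := by
  obtain ⟨f, t, hfA, hfB⟩ := geometric_hahn_banach_open_open hA hAo hB hBo hAB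
  set c : ℂ := ⟨f 1, - f Complex.I⟩ with hc
  have hf : ∀ z : ℂ, (c * z).re = f z := fun z => by
    have hz : z = z.re • (1 : ℂ) + z.im • Complex.I := by simp
    conv_rhs => rw [hz, map_add, map_smul, map_smul]
    simp [hc, mul_comm]
  have hpos : ∀ a ∈ A, ∀ b ∈ B, 0 < (c * (b - a)).re := fun a ha b hb => by
    rw [hf, map_sub]
    linarith [hfA a ha, hfB b hb]
  have hc0 : c ≠ 0 := fun h => by
    have := hpos p hp u hu
    simp [h] at this
  have key : ∀ a ∈ A, ∀ b ∈ B, ∀ a' ∈ A, ∀ b' ∈ B, ((b - a) / (b' - a')).arg =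
      (c * (b - a)).arg - (c * (b' - a')).arg := fun a ha b hb a' ha' b' hb' => by
    rw [← arg_div_of_re_pos (hpos a ha b hb) (hpos a' ha' b' hb'), mul_div_mul_left _ _ hc0]
  have h1 : ∀ w ∈ B, subtended p q w = (c * (w - q)).arg - (c * (w - p)).arg := fun w hw => by
    rw [subtended, ← key q hq w hw p hp w hw, ← neg_sub w q, ← neg_sub w p, neg_div_neg_eq]
  have h2 : ∀ w ∈ A, subtended u v w = (c * (v - w)).arg - (c * (u - w)).arg := fun w hw =>
    key w hw v hv w hw u hu
  rw [h1 u hu, h1 v hv, h2 p hp, h2 q hq]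
  ring

/-- The total angle under which the polygonal path `P` is seen from `u`. -/
noncomputable def pathSubtended (P : Fin 4 → ℂ) (u : ℂ) : ℝ :=
  ∑ k : Fin 3, subtended (P k.castSucc) (P k.succ) u

theorem pathSubtended_rectangle {A B : Fin 3 → Set ℂ} {P Q : Fin 4 → ℂ}
    (hA : ∀ k, Convex ℝ (A k) ∧ IsOpen (A k)) (hB : ∀ k, Convex ℝ (B k) ∧ IsOpen (B k))
    (hAB : ∀ k l, Disjoint (A k) (B l))
    (hP : ∀ k : Fin 3, P k.castSucc ∈ A k ∧ P k.succ ∈ A k)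
    (hQ : ∀ k : Fin 3, Q k.castSucc ∈ B k ∧ Q k.succ ∈ B k) :
    pathSubtended P (Q 0) + pathSubtended Q (P 3) =
      pathSubtended P (Q 3) + pathSubtended Q (P 0) := by
  have key := fun k l => subtended_rectangle (hA k).1 (hA k).2 (hB l).1 (hB l).2 (hAB k l)
    (hP k).1 (hP k).2 (hQ l).1 (hQ l).2
  simp only [pathSubtended, Fin.sum_univ_three]
  have h00 := key 0 0
  have h01 := key 0 1
  have h02 := key 0 2
  have h10 := key 1 0
  have h11 := key 1 1
  have h12 := key 1 2
  have h20 := key 2 0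
  have h21 := key 2 1
  have h22 := key 2 2
  simp only [show (0 : Fin 3).castSucc = 0 from rfl, show (0 : Fin 3).succ = 1 from rfl,
    show (1 : Fin 3).castSucc = 1 from rfl, show (1 : Fin 3).succ = 2 from rfl,
    show (2 : Fin 3).castSucc = 2 from rfl, show (2 : Fin 3).succ = 3 from rfl] at *
  linarith

theorem coe_subtended {p q u : ℂ} (hp : p ≠ u) (hq : q ≠ u) :
    (subtended p q u : Real.Angle) = (q - u).arg - (p - u).arg :=
  Complex.arg_div_coe_angle (sub_ne_zero.2 hq) (sub_ne_zero.2 hp)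

theorem coe_pathSubtended {P : Fin 4 → ℂ} {u : ℂ} (h : ∀ k, P k ≠ u) :
    (pathSubtended P u : Real.Angle) = (P 3 - u).arg - (P 0 - u).arg := by
  simp only [pathSubtended, Fin.sum_univ_three, Real.Angle.coe_add, coe_subtended (h _) (h _)]
  simp only [show (0 : Fin 3).castSucc = 0 from rfl, show (0 : Fin 3).succ = 1 from rfl,
    show (1 : Fin 3).castSucc = 1 from rfl, show (1 : Fin 3).succ = 2 from rfl,
    show (2 : Fin 3).castSucc = 2 from rfl, show (2 : Fin 3).succ = 3 from rfl]
  abel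

/-! ### The obstruction in the plane -/

/-- A form of the nonplanarity of `K₃,₃`. Think of `a i j w` as the total angle under which an
edge from `x i` to `y j` is seen from the vertex `w`. -/
theorem bipartite_angle_obstruction {x y : Fin 3 → ℂ} (hx : ∀ i k, i ≠ k → x i ≠ x k)
    (hxy : ∀ i j, x i ≠ y j) (a : Fin 3 → Fin 3 → ℂ → ℝ)
    (hax : ∀ i j k, k ≠ i → (a i j (x k) : Real.Angle) = (y j - x k).arg - (x i - x k).arg)
    (hay : ∀ i j l, l ≠ j → (a i j (y l) : Real.Angle) = (y j - y l).arg - (x i - y l).arg)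
    (h : ∀ i j k l, i ≠ k → j ≠ l →
      a i j (x k) + a k l (y j) = a i j (y l) + a k l (x i)) : False := by
  have total : ∑ j, (a 0 j (x 1) + a 0 j (x 2) + a 1 j (x 2) - a 1 j (x 0) - a 2 j (x 0)
      - a 2 j (x 1)) + (a 2 0 (y 1) + a 2 0 (y 2) + a 2 1 (y 0) + a 2 1 (y 2) + a 2 2 (y 0)
      + a 2 2 (y 1)) - (a 0 0 (y 1) + a 0 0 (y 2) + a 0 1 (y 0) + a 0 1 (y 2) + a 0 2 (y 0)
      + a 0 2 (y 1)) = 0 := by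
    have e := fun i k (hik : i ≠ k) =>
      And.intro (h i 0 k 1 hik (by decide)) <| And.intro (h i 0 k 2 hik (by decide)) <|
      And.intro (h i 1 k 0 hik (by decide)) <| And.intro (h i 1 k 2 hik (by decide)) <|
      And.intro (h i 2 k 0 hik (by decide)) (h i 2 k 1 hik (by decide))
    obtain ⟨_, _, _, _, _, _⟩ := e 0 1 (by decide)
    obtain ⟨_, _, _, _, _, _⟩ := e 0 2 (by decide)
    obtain ⟨_, _, _, _, _, _⟩ := e 1 2 (by decide)
    rw [Fin.sum_univ_three]
    linarith
  have total' := congrArg (fun t : ℝ => (t : Real.Angle)) total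
  have flip : ∀ z w : ℂ, z ≠ w →
      ((w - z).arg : Real.Angle) = (z - w).arg + (Real.pi : Real.Angle) := fun z w hzw => by
    rw [← neg_sub z w, Complex.arg_neg_coe_angle (sub_ne_zero.2 hzw)]
  simp (discharger := decide) only [Fin.sum_univ_three, Real.Angle.coe_add, Real.Angle.coe_sub,
    Real.Angle.coe_zero, hax, hay] at total'
  have two_pi : (Real.pi : Real.Angle) + Real.pi = 0 := by
    rw [← Real.Angle.coe_add, ← two_mul, Real.Angle.coe_two_pi]
  refine Real.Angle.pi_ne_zero ?_
  rw [flip (x 0) (x 1) (hx _ _ (by decide)), flip (x 0) (x 2) (hx _ _ (by decide)),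
    flip (x 1) (x 2) (hx _ _ (by decide))] at total'
  simp only [fun i j => flip (x i) (y j) (hxy i j)] at total'
  have eight_pi : 4 • ((Real.pi : Real.Angle) + Real.pi) = 0 := by rw [two_pi, smul_zero]
  refine Eq.trans ?_ (sub_eq_zero.2 (total'.trans eight_pi.symm))
  abel

/-- Disjointness up to the prescribed overlaps is impossible for open convex sets in the plane. -/
theorem not_exists_convex_plane {X Y : Fin 3 → Set ℂ} {R : Fin 3 → Fin 3 → Set ℂ}
    (hX : ∀ i, Convex ℝ (X i) ∧ IsOpen (X i)) (hY : ∀ j, Convex ℝ (Y j) ∧ IsOpen (Y j))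
    (hR : ∀ i j, Convex ℝ (R i j) ∧ IsOpen (R i j))
    (hRX : ∀ i j, (R i j ∩ X i).Nonempty) (hRY : ∀ i j, (R i j ∩ Y j).Nonempty)
    (dX : ∀ i k, i ≠ k → Disjoint (X i) (X k)) (dY : ∀ j l, j ≠ l → Disjoint (Y j) (Y l))
    (dXY : ∀ i j, Disjoint (X i) (Y j))
    (dR : ∀ i j k l, (i, j) ≠ (k, l) → Disjoint (R i j) (R k l))
    (dRX : ∀ i j k, k ≠ i → Disjoint (R i j) (X k))
    (dRY : ∀ i j l, l ≠ j → Disjoint (R i j) (Y l)) : False := by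
  choose p hpR hpX using hRX
  choose q hqR hqY using hRY
  let x : Fin 3 → ℂ := fun i => p i 0
  let y : Fin 3 → ℂ := fun j => q 0 j
  let S : Fin 3 → Fin 3 → Fin 3 → Set ℂ := fun i j => ![X i, R i j, Y j]
  let P : Fin 3 → Fin 3 → Fin 4 → ℂ := fun i j => ![x i, p i j, q i j, y j]
  have hS : ∀ i j k, Convex ℝ (S i j k) ∧ IsOpen (S i j k) := fun i j k => by
    fin_cases k
    exacts [hX i, hR i j, hY j]
  have hP : ∀ i j (k : Fin 3), P i j k.castSucc ∈ S i j k ∧ P i j k.succ ∈ S i j k :=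
    fun i j k => by
      fin_cases k
      exacts [⟨hpX i 0, hpX i j⟩, ⟨hpR i j, hqR i j⟩, ⟨hqY i j, hqY 0 j⟩]
  have hd : ∀ i j k l, i ≠ k → j ≠ l → ∀ m n, Disjoint (S i j m) (S k l n) :=
    fun i j k l hik hjl m n => by
      fin_cases m <;> fin_cases n
      exacts [dX i k hik, (dRX k l i hik).symm, dXY i l, dRX i j k hik.symm,
        dR i j k l fun h => hik (congrArg Prod.fst h), dRY i j l hjl.symm, (dXY k j).symm,
        (dRY k l j hjl).symm, dY j l hjl]
  have ne : ∀ {A B : Set ℂ} {s t : ℂ}, Disjoint A B → s ∈ A → t ∈ B → s ≠ t :=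
    fun hAB hs ht => hAB.ne_of_mem hs ht
  have hP0 : ∀ i j, P i j 0 = x i := fun i j => rfl
  have hP3 : ∀ i j, P i j 3 = y j := fun i j => rfl
  have hrect := fun i j k l hik hjl =>
    pathSubtended_rectangle (hS i j) (hS k l) (hd i j k l hik hjl) (hP i j) (hP k l)
  have hang := fun i j u (h : ∀ m, P i j m ≠ u) => coe_pathSubtended h
  simp only [hP0, hP3] at hrect hang
  refine bipartite_angle_obstruction
    (fun i k hik => ne (dX i k hik) (hpX i 0) (hpX k 0))
    (fun i j => ne (dXY i j) (hpX i 0) (hqY 0 j)) (fun i j => pathSubtended (P i j))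
    (fun i j k hk => hang i j (x k) fun m => ?_)
    (fun i j l hl => hang i j (y l) fun m => ?_) hrect
  · fin_cases m
    exacts [ne (dX i k hk.symm) (hpX i 0) (hpX k 0), ne (dX i k hk.symm) (hpX i j) (hpX k 0),
      ne (dRX i j k hk) (hqR i j) (hpX k 0), ne (dXY k j).symm (hqY 0 j) (hpX k 0)]
  · fin_cases m
    exacts [ne (dXY i l) (hpX i 0) (hqY 0 l), ne (dXY i l) (hpX i j) (hqY 0 l),
      ne (dRY i j l hl) (hqR i j) (hqY 0 l), ne (dY j l hl.symm) (hqY 0 j) (hqY 0 l)]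

/-- There is a consistent atomic RCC5 network over {DR, PO} with no convex
solution in ℝ². -/
theorem statement10 :
    (∃ (x y : Fin 3 → Set (EuclideanSpace ℝ (Fin 3)))
       (r : Fin 3 → Fin 3 → Set (EuclideanSpace ℝ (Fin 3))),
      (∀ i, (x i).Nonempty ∧ RegClosed (x i)) ∧
      (∀ i, (y i).Nonempty ∧ RegClosed (y i)) ∧
      (∀ i j, (r i j).Nonempty ∧ RegClosed (r i j)) ∧
      Network10 x y r) ∧
    ¬ (∃ (x y : Fin 3 → Set (EuclideanSpace ℝ (Fin 2)))
        (r : Fin 3 → Fin 3 → Set (EuclideanSpace ℝ (Fin 2))),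
      (∀ i, (x i).Nonempty ∧ Convex ℝ (x i) ∧ RegClosed (x i)) ∧
      (∀ i, (y i).Nonempty ∧ Convex ℝ (y i) ∧ RegClosed (y i)) ∧
      (∀ i j, (r i j).Nonempty ∧ Convex ℝ (r i j) ∧ RegClosed (r i j)) ∧
      Network10 x y r) := by
  refine ⟨exists_network10 (v := EuclideanSpace.single 0 1) (by simp), ?_⟩
  rintro ⟨x, y, r, hx, hy, hr, hrx, hry, dx, dy, dxy, dr, drx, dry⟩
  let e := Complex.orthonormalBasisOneI.repr
  have good : ∀ A : Set (EuclideanSpace ℝ (Fin 2)), Convex ℝ A →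
      Convex ℝ (e ⁻¹' interior A) ∧ IsOpen (e ⁻¹' interior A) := fun A hA =>
    ⟨hA.interior.linear_preimage e.toLinearEquiv.toLinearMap,
      isOpen_interior.preimage e.continuous⟩
  have meet : ∀ {A B : Set (EuclideanSpace ℝ (Fin 2))}, PO A B →
      (e ⁻¹' interior A ∩ e ⁻¹' interior B).Nonempty := fun h => by
    obtain ⟨z, hz⟩ := h.1
    exact ⟨e.symm z, by simpa using hz⟩
  have disj : ∀ {A B : Set (EuclideanSpace ℝ (Fin 2))}, DR A B →
      Disjoint (e ⁻¹' interior A) (e ⁻¹' interior B) := fun h =>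
    (Set.disjoint_iff_inter_eq_empty.2 h).preimage e
  exact not_exists_convex_plane (fun i => good _ (hx i).2.1) (fun j => good _ (hy j).2.1)
    (fun i j => good _ (hr i j).2.1) (fun i j => meet (hrx i j)) (fun i j => meet (hry i j))
    (fun i k h => disj (dx i k h)) (fun j l h => disj (dy j l h)) (fun i j => disj (dxy i j))
    (fun i j k l h => disj (dr i j k l h)) (fun i j k h => disj (drx i j k h))
    fun i j l h => disj (dry i j l h)
end

section
/- Let A : Fin m → Set (ℝ^d) be a family of nonempty regular closed subsets of a Euclidean space ℝ^d such that for all i ≠ j one of EC(A i, A j), DC(A i, A j), PO(A i, A j) holds. Then there exists a family B : Fin m → Set ℝ³ of nonempty convex regular closed subsets of ℝ³ such that for all i ≠ j, EC(B i, B j) holds iff EC(A i, A j) holds, DC(B i, B j) holds iff DC(A i, A j) holds, and PO(B i, B j) holds iff PO(A i, A j) holds. (Every consistent atomic RCC8 network over {EC, DC, PO} has a convex solution in ℝ³.) -/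
/-- The value at `t` of the quartic `-t⁴ + x₂ t³ + x₁ t² + x₀ t`. -/
noncomputable def quarticValue (t : ℝ) (x : EuclideanSpace ℝ (Fin 3)) : ℝ :=
  x 0 * t + x 1 * t ^ 2 + x 2 * t ^ 3 - t ^ 4

/-- The coefficients for which the quartic is `-(t - a)² (t - b)²` up to a constant. -/
noncomputable def doubleRootPoint (a b : ℝ) : EuclideanSpace ℝ (Fin 3) :=
  !₂[2 * a * b * (a + b), -((a + b) ^ 2 + 2 * a * b), 2 * (a + b)]

/-- The polyhedron of quartics whose value at `i` exceeds that at `k` by at least `c i k`. -/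
def quarticCell {m : ℕ} (c : Fin m → Fin m → ℝ) (i : Fin m) :
    Set (EuclideanSpace ℝ (Fin 3)) :=
  {x | ∀ k, k ≠ i → c i k ≤ quarticValue (i : ℝ) x - quarticValue (k : ℝ) x}

lemma continuous_quarticValue (t : ℝ) : Continuous (quarticValue t) := by
  unfold quarticValue
  fun_prop

lemma quarticValue_doubleRootPoint (a b t : ℝ) :
    quarticValue a (doubleRootPoint a b) - quarticValue t (doubleRootPoint a b) =
      (t - a) ^ 2 * (t - b) ^ 2 := by
  simp [quarticValue, doubleRootPoint]
  ring

lemma doubleRootPoint_comm (a b : ℝ) : doubleRootPoint a b = doubleRootPoint b a := by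
  simp only [doubleRootPoint, add_comm b a, mul_right_comm 2 b a]

lemma one_le_sq_natCast_sub {a b : ℕ} (h : a ≠ b) : (1 : ℝ) ≤ ((a : ℝ) - b) ^ 2 := by
  have h1 : (a : ℤ) - b ≠ 0 := by omega
  have h2 : (1 : ℤ) ≤ ((a : ℤ) - b) ^ 2 := by
    have := sq_pos_of_ne_zero h1
    omega
  exact_mod_cast h2

lemma one_le_quarticValue_sub {a b k : ℕ} (ha : k ≠ a) (hb : k ≠ b) :
    1 ≤ quarticValue a (doubleRootPoint a b) - quarticValue k (doubleRootPoint a b) := by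
  rw [quarticValue_doubleRootPoint]
  exact one_le_mul_of_one_le_of_one_le (one_le_sq_natCast_sub ha) (one_le_sq_natCast_sub hb)

section Cells

variable {m : ℕ} {c : Fin m → Fin m → ℝ}

lemma convex_quarticCell (c : Fin m → Fin m → ℝ) (i : Fin m) :
    Convex ℝ (quarticCell c i) := by
  intro x hx y hy a b ha hb hab k hk
  have h1 := mul_le_mul_of_nonneg_left (hx k hk) ha
  have h2 := mul_le_mul_of_nonneg_left (hy k hk) hb
  have hb' : b = 1 - a := by linarith
  subst hb'
  simp only [quarticValue, PiLp.add_apply, PiLp.smul_apply, smul_eq_mul] at *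
  nlinarith

lemma isClosed_quarticCell (c : Fin m → Fin m → ℝ) (i : Fin m) :
    IsClosed (quarticCell c i) := by
  simp only [quarticCell, Set.ofPred_forall]
  exact isClosed_iInter fun k => isClosed_iInter fun _ => isClosed_le continuous_const
    ((continuous_quarticValue _).sub (continuous_quarticValue _))

lemma mem_interior_quarticCell {i : Fin m} {x : EuclideanSpace ℝ (Fin 3)}
    (hx : ∀ k : Fin m, k ≠ i → c i k < quarticValue (i : ℝ) x - quarticValue (k : ℝ) x) :
    x ∈ interior (quarticCell c i) := by
  have hopen : IsOpen {y : EuclideanSpace ℝ (Fin 3) | ∀ k : Fin m, k ≠ i →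
      c i k < quarticValue (i : ℝ) y - quarticValue (k : ℝ) y} := by
    simp only [Set.ofPred_forall]
    exact isOpen_iInter_of_finite fun k => isOpen_iInter_of_finite fun _ =>
      isOpen_lt continuous_const ((continuous_quarticValue _).sub (continuous_quarticValue _))
  exact interior_maximal (fun y hy k hk => (hy k hk).le) hopen hx

lemma doubleRootPoint_self_mem_interior (hc : ∀ i j, c i j < 1) (i : Fin m) :
    doubleRootPoint i i ∈ interior (quarticCell c i) :=
  mem_interior_quarticCell fun k hk =>
    have hki : (k : ℕ) ≠ i := Fin.val_ne_of_ne hk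
    (hc i k).trans_le (one_le_quarticValue_sub hki hki)

lemma regClosed_quarticCell (hc : ∀ i j, c i j < 1) (i : Fin m) :
    RegClosed (quarticCell c i) := by
  have h := (convex_quarticCell c i).closure_interior_eq_closure_of_nonempty_interior
    ⟨_, doubleRootPoint_self_mem_interior hc i⟩
  rwa [(isClosed_quarticCell c i).closure_eq] at h

lemma doubleRootPoint_mem (hc : ∀ i j, c i j < 1) {i j : Fin m} (hcij : c i j ≤ 0) :
    doubleRootPoint i j ∈ quarticCell c i := by
  intro k hk
  by_cases hkj : k = j
  · subst hkj
    rw [quarticValue_doubleRootPoint]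
    simpa using hcij
  · exact (hc i k).le.trans
      (one_le_quarticValue_sub (Fin.val_ne_of_ne hk) (Fin.val_ne_of_ne hkj))

lemma doubleRootPoint_mem_interior (hc : ∀ i j, c i j < 1) {i j : Fin m} (hcij : c i j < 0) :
    doubleRootPoint i j ∈ interior (quarticCell c i) := by
  refine mem_interior_quarticCell fun k hk => ?_
  by_cases hkj : k = j
  · subst hkj
    rw [quarticValue_doubleRootPoint]
    simpa using hcij
  · exact (hc i k).trans_le
      (one_le_quarticValue_sub (Fin.val_ne_of_ne hk) (Fin.val_ne_of_ne hkj))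

lemma dc_quarticCell {i j : Fin m} (hij : i ≠ j) (h : 0 < c i j + c j i) :
    DC (quarticCell c i) (quarticCell c j) := by
  refine Set.eq_empty_of_forall_notMem fun x hx => ?_
  linarith [hx.1 j hij.symm, hx.2 i hij]

lemma ec_quarticCell (hc : ∀ i j, c i j < 1) {i j : Fin m} (hij : i ≠ j)
    (h : c i j = 0) (h' : c j i = 0) : EC (quarticCell c i) (quarticCell c j) := by
  refine ⟨⟨doubleRootPoint i j, doubleRootPoint_mem hc h.le, ?_⟩, ?_⟩
  · rw [doubleRootPoint_comm]
    exact doubleRootPoint_mem hc h'.le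
  refine Set.eq_empty_of_forall_notMem fun x hx => ?_
  have heq : ∀ y ∈ quarticCell c i ∩ quarticCell c j,
      quarticValue (i : ℝ) y = quarticValue (j : ℝ) y := fun y hy => by
    linarith [hy.1 j hij.symm, hy.2 i hij]
  let e : EuclideanSpace ℝ (Fin 3) := !₂[1, 0, 0]
  have hcont : Filter.Tendsto (fun s : ℝ => x + s • e) (nhds 0) (nhds x) := by
    have : Continuous fun s : ℝ => x + s • e := by fun_prop
    simpa using this.tendsto 0
  rw [← interior_inter] at hx
  have hev := (hcont.eventually (mem_interior_iff_mem_nhds.mp hx)).filter_mono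
    (nhdsWithin_le_nhds (s := {0}ᶜ))
  obtain ⟨s, hs, hs0⟩ := (hev.and self_mem_nhdsWithin).exists
  have h0 := heq x (interior_subset hx)
  have h1 := heq _ hs
  have hne : (i : ℝ) - (j : ℝ) ≠ 0 :=
    sub_ne_zero.mpr (Nat.cast_injective.ne (Fin.val_ne_of_ne hij))
  refine mul_ne_zero hs0 hne ?_
  simp [quarticValue, e] at h0 h1
  linarith

lemma not_quarticCell_subset (hc : ∀ i j, c i j < 1) {i j : Fin m} (hij : i ≠ j)
    (h : -1 < c j i) : ¬ quarticCell c i ⊆ quarticCell c j := fun hsub => by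
  have h1 := hsub (interior_subset (doubleRootPoint_self_mem_interior hc i)) i hij
  have hji : (j : ℕ) ≠ i := Fin.val_ne_of_ne hij.symm
  linarith [one_le_quarticValue_sub hji hji]

lemma po_quarticCell (hc : ∀ i j, c i j < 1) {i j : Fin m} (hij : i ≠ j)
    (h : c i j < 0) (h' : c j i < 0) (hl : -1 < c i j) (hl' : -1 < c j i) :
    PO (quarticCell c i) (quarticCell c j) := by
  refine ⟨⟨doubleRootPoint i j, doubleRootPoint_mem_interior hc h, ?_⟩,
    not_quarticCell_subset hc hij hl', not_quarticCell_subset hc hij.symm hl⟩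
  rw [doubleRootPoint_comm]
  exact doubleRootPoint_mem_interior hc h'

end Cells

section Relations

variable {α : Type*} {a b : Set α}

lemma DC.comm : DC a b ↔ DC b a := by
  rw [DC, DC, Set.inter_comm]

variable [TopologicalSpace α]

lemma EC.comm : EC a b ↔ EC b a := by
  rw [EC, EC, Set.inter_comm, Set.inter_comm (interior a)]

lemma EC.not_dc (h : EC a b) : ¬ DC a b := h.1.ne_empty

lemma PO.not_ec (h : PO a b) : ¬ EC a b := fun h' => h.1.ne_empty h'.2

lemma PO.not_dc (h : PO a b) : ¬ DC a b :=
  (h.1.mono (Set.inter_subset_inter interior_subset interior_subset)).ne_empty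

end Relations

open Classical in
/-- The margin encoding the relation between two regions: zero for external connection,
positive for disconnection and negative for overlap. -/
noncomputable def relationMargin {α : Type*} [TopologicalSpace α] (a b : Set α) : ℝ :=
  if EC a b then 0 else if DC a b then 1 / 2 else -(1 / 2)

lemma relationMargin_comm {α : Type*} [TopologicalSpace α] (a b : Set α) :
    relationMargin a b = relationMargin b a := by
  have hec : EC a b = EC b a := propext EC.comm
  have hdc : DC a b = DC b a := propext DC.comm
  unfold relationMargin
  rw [hec, hdc]

lemma relationMargin_lt_one {α : Type*} [TopologicalSpace α] (a b : Set α) :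
    relationMargin a b < 1 := by
  unfold relationMargin
  split_ifs <;> norm_num

/-- Every consistent atomic RCC8 network over {EC, DC, PO} has a convex
solution in ℝ³. -/
theorem statement12 (m d : ℕ) (A : Fin m → Set (EuclideanSpace ℝ (Fin d)))
    (hA : ∀ i, (A i).Nonempty ∧ RegClosed (A i))
    (hrel : ∀ i j : Fin m, i ≠ j →
      EC (A i) (A j) ∨ DC (A i) (A j) ∨ PO (A i) (A j)) :
    ∃ B : Fin m → Set (EuclideanSpace ℝ (Fin 3)),
      (∀ i, (B i).Nonempty ∧ Convex ℝ (B i) ∧ RegClosed (B i)) ∧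
      (∀ i j : Fin m, i ≠ j →
        (EC (B i) (B j) ↔ EC (A i) (A j)) ∧
        (DC (B i) (B j) ↔ DC (A i) (A j)) ∧
        (PO (B i) (B j) ↔ PO (A i) (A j))) := by
  set c : Fin m → Fin m → ℝ := fun i j => relationMargin (A i) (A j)
  have hc : ∀ i j, c i j < 1 := fun i j => relationMargin_lt_one _ _
  refine ⟨quarticCell c, fun i =>
    ⟨⟨_, interior_subset (doubleRootPoint_self_mem_interior hc i)⟩, convex_quarticCell c i,
      regClosed_quarticCell hc i⟩, fun i j hij => ?_⟩
  have hsymm : c j i = c i j := relationMargin_comm _ _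
  rcases hrel i j hij with h | h | h
  · have hv : c i j = 0 := if_pos h
    have hB := ec_quarticCell hc hij hv (hsymm.trans hv)
    exact ⟨iff_of_true hB h, iff_of_false hB.not_dc h.not_dc,
      iff_of_false (fun h' => h'.not_ec hB) (fun h' => h'.not_ec h)⟩
  · have hv : c i j = 1 / 2 := (if_neg fun h' => h'.not_dc h).trans (if_pos h)
    have hB := dc_quarticCell (c := c) hij (by rw [hsymm, hv]; norm_num)
    exact ⟨iff_of_false (fun h' => h'.not_dc hB) (fun h' => h'.not_dc h), iff_of_true hB h,
      iff_of_false (fun h' => h'.not_dc hB) (fun h' => h'.not_dc h)⟩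
  · have hv : c i j = -(1 / 2) := (if_neg h.not_ec).trans (if_neg h.not_dc)
    have hB : PO (quarticCell c i) (quarticCell c j) := by
      apply po_quarticCell hc hij <;> norm_num [hsymm, hv]
    exact ⟨iff_of_false hB.not_ec h.not_ec, iff_of_false hB.not_dc h.not_dc, iff_of_true hB h⟩
end
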